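/- arXiv:2402.09131 — 2 statements merged into one kernel-verified Lean document; each statement's English description precedes it below -/
import Mathlib

section
/- Let P be a penny configuration in general position and let A ∈ P have degree exactly 4. Then A has an unpopular unit-neighbor that does not belong to any kernel: there exists B ∈ P with dist(A,B) = 1 such that B is unpopular and B is not one of the four points of any kernel of P. -/
open Real EuclideanGeometry

/-- The Euclidean plane. -/
abbrev Pt := EuclideanSpace ℝ (Fin 2)

/-- A penny configuration in general position: a finite set of points in the plane
such that any two distinct points are at distance at least 1 and no three points
are collinear. -/
def PennyGP (P : Finset Pt) : Prop :=
  (∀ p ∈ P, ∀ q ∈ P, p ≠ q → 1 ≤ dist p q) ∧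
  (∀ p ∈ P, ∀ q ∈ P, ∀ r ∈ P, p ≠ q → p ≠ r → q ≠ r →
    ¬ Collinear ℝ ({p, q, r} : Set Pt))

/-- The degree of a point `A` in the penny graph of `P`: the number of points of `P`
at distance exactly 1 from `A`. -/
noncomputable def deg (P : Finset Pt) (A : Pt) : ℕ :=
  {q : Pt | q ∈ P ∧ dist A q = 1}.ncard

/-- A kernel: four distinct points of `P`, each of degree 5, with the five unit
distances `LU`, `UR`, `RD`, `DL`, `LR`. -/
def IsKernel (P : Finset Pt) (L U R D : Pt) : Prop :=
  L ∈ P ∧ U ∈ P ∧ R ∈ P ∧ D ∈ P ∧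
  List.Pairwise (· ≠ ·) [L, U, R, D] ∧
  deg P L = 5 ∧ deg P U = 5 ∧ deg P R = 5 ∧ deg P D = 5 ∧
  dist L U = 1 ∧ dist U R = 1 ∧ dist R D = 1 ∧ dist D L = 1 ∧ dist L R = 1

/-- A point belongs to a kernel if it is one of the four points of some kernel of `P`. -/
def InKernel (P : Finset Pt) (X : Pt) : Prop :=
  ∃ L U R D : Pt, IsKernel P L U R D ∧ X ∈ ({L, U, R, D} : Set Pt)

/-- A point `B ∈ P` is unpopular if `deg B ≤ 4`, or `deg B = 5` and some
unit-neighbor of `B` has degree at most 3, or `deg B = 5` and at least two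
unit-neighbors of `B` have degree 4. Otherwise it is popular. -/
def Unpopular (P : Finset Pt) (B : Pt) : Prop :=
  deg P B ≤ 4 ∨
  (deg P B = 5 ∧ ∃ C ∈ P, dist B C = 1 ∧ deg P C ≤ 3) ∨
  (deg P B = 5 ∧ ∃ C ∈ P, ∃ C' ∈ P, C ≠ C' ∧ dist B C = 1 ∧ dist B C' = 1 ∧
    deg P C = 4 ∧ deg P C' = 4)

open ComplexConjugate

/-- The point of the unit circle at angle `θ`. -/
noncomputable def cis (θ : ℝ) : ℂ := Complex.exp (θ * Complex.I)

lemma cis_re (θ : ℝ) : (cis θ).re = cos θ := Complex.exp_ofReal_mul_I_re θ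

lemma cis_im (θ : ℝ) : (cis θ).im = sin θ := Complex.exp_ofReal_mul_I_im θ

lemma cis_add (x y : ℝ) : cis (x + y) = cis x * cis y := by
  simp only [cis, ← Complex.exp_add]
  push_cast
  ring_nf

@[simp] lemma cis_zero : cis 0 = 1 := by simp [cis]

@[simp] lemma cis_pi : cis π = -1 := by simp [cis]

@[simp] lemma cis_two_pi : cis (2 * π) = 1 := by
  rw [two_mul, cis_add]
  simp

lemma cis_mul_cis_neg (x : ℝ) : cis x * cis (-x) = 1 := by
  rw [← cis_add]
  simp

lemma cis_ne_zero (x : ℝ) : cis x ≠ 0 := Complex.exp_ne_zero _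

@[simp] lemma norm_cis (x : ℝ) : ‖cis x‖ = 1 := Complex.norm_exp_ofReal_mul_I x

lemma conj_cis (x : ℝ) : conj (cis x) = cis (-x) := by
  apply Complex.ext <;> simp [cis_re, cis_im]

lemma cis_pi_div_three_sub_one : cis (π / 3) - 1 = cis (2 * π / 3) := by
  have h1 : cos (2 * π / 3) = -(1 / 2) := by
    rw [show 2 * π / 3 = π - π / 3 by ring, cos_pi_sub, cos_pi_div_three]
  have h2 : sin (2 * π / 3) = √3 / 2 := by
    rw [show 2 * π / 3 = π - π / 3 by ring, sin_pi_sub, sin_pi_div_three]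
  apply Complex.ext
  · simp only [Complex.sub_re, cis_re, Complex.one_re, h1, cos_pi_div_three]
    norm_num
  · simp only [Complex.sub_im, cis_im, Complex.one_im, h2, sin_pi_div_three]
    norm_num

lemma cis_two_pi_div_three : cis (2 * π / 3) = cis (π / 3) * cis (π / 3) := by
  rw [← cis_add]
  ring_nf

/-- The sixth root of unity satisfies its minimal equation. -/
lemma cis_pi_div_three_sq : cis (π / 3) ^ 2 = cis (π / 3) - 1 := by
  rw [cis_pi_div_three_sub_one, cis_two_pi_div_three, sq]

lemma cis_neg_pi_div_three : cis (-(π / 3)) = 1 - cis (π / 3) := by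
  have h := cis_mul_cis_neg (π / 3)
  have h' := cis_pi_div_three_sq
  have h0 := cis_ne_zero (π / 3)
  apply mul_left_cancel₀ h0
  linear_combination h + h'

lemma normSq_cis_sub_one (g : ℝ) : Complex.normSq (cis g - 1) = 2 - 2 * cos g := by
  rw [Complex.normSq_apply]
  simp only [Complex.sub_re, Complex.sub_im, cis_re, cis_im, Complex.one_re, Complex.one_im]
  linear_combination sin_sq_add_cos_sq g

/-- Every unit complex number is `cis θ` for some angle in `[0, 2π)`. -/
lemma exists_cis_eq {z : ℂ} (hz : ‖z‖ = 1) : ∃ θ, 0 ≤ θ ∧ θ < 2 * π ∧ cis θ = z := by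
  have h : cis z.arg = z := by
    have := Complex.norm_mul_exp_arg_mul_I z
    rwa [hz, Complex.ofReal_one, one_mul] at this
  rcases le_or_gt 0 z.arg with h0 | h0
  · exact ⟨z.arg, h0, by linarith [Complex.arg_le_pi z, pi_pos], h⟩
  · refine ⟨z.arg + 2 * π, by linarith [Complex.neg_pi_lt_arg z], by linarith, ?_⟩
    rw [cis_add, cis_two_pi, mul_one, h]

lemma cis_injOn : Set.InjOn cis (Set.Ico 0 (2 * π)) := by
  intro x hx y hy h
  have h1 : cis (x - y) = 1 := by
    rw [sub_eq_add_neg, cis_add, h, cis_mul_cis_neg]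
  have h2 : cos (x - y) = 1 := by rw [← cis_re, h1, Complex.one_re]
  rw [cos_eq_one_iff_of_lt_of_lt (by linarith [hx.1, hy.2]) (by linarith [hx.2, hy.1])] at h2
  linarith

/-- Distinct points of `S` are at distance at least one. -/
def Separated (S : Set ℂ) : Prop := ∀ p ∈ S, ∀ q ∈ S, p ≠ q → 1 ≤ ‖p - q‖

/-- No three points of `S` are collinear. -/
def NoCollinear (S : Set ℂ) : Prop :=
  ∀ p ∈ S, ∀ a b : ℂ, p + a ∈ S → p + b ∈ S → a ≠ 0 → b ≠ 0 → a ≠ b → (a * conj b).im ≠ 0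

/-- The unit vectors `u` and `w = u * cis g` are consecutive directions, counterclockwise,
from `v` to points of `S` at distance one. -/
structure Gap (S : Set ℂ) (v u : ℂ) (g : ℝ) (w : ℂ) : Prop where
  norm_left : ‖u‖ = 1
  left : v + u ∈ S
  right : v + w ∈ S
  eq : w = u * cis g
  le : π / 3 ≤ g
  empty : ∀ φ, 0 < φ → φ < g → v + u * cis φ ∉ S

/-- The directions `d i` from `v` to its `n` unit neighbours in `S`, in counterclockwise order,
with the angles `g i` between consecutive ones. -/
structure Fan {n : ℕ} [NeZero n] (S : Set ℂ) (v : ℂ) (d : Fin n → ℂ) (g : Fin n → ℝ) : Prop where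
  mem : v ∈ S
  gap : ∀ i, Gap S v (d i) (g i) (d (i + 1))
  sum : ∑ i, g i = 2 * π

/-- The point `v` has `n` unit neighbours in `S`. -/
def HasFans (n : ℕ) [NeZero n] (S : Set ℂ) (v : ℂ) : Prop :=
  ∀ u, ‖u‖ = 1 → v + u ∈ S → ∃ d g, Fan (n := n) S v d g ∧ d 0 = u

section Local

variable {S : Set ℂ}

lemma Gap.pos {v u w : ℂ} {g : ℝ} (h : Gap S v u g w) : 0 < g :=
  lt_of_lt_of_le (by positivity) h.le

lemma Gap.norm_right {v u w : ℂ} {g : ℝ} (h : Gap S v u g w) : ‖w‖ = 1 := by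
  rw [h.eq, norm_mul, h.norm_left, norm_cis, one_mul]

lemma Gap.left_eq {v u w : ℂ} {g : ℝ} (h : Gap S v u g w) : u = w * cis (-g) := by
  rw [h.eq, mul_assoc, cis_mul_cis_neg, mul_one]

/-- If the angle `g` after the edge `vp` at `v` is the angle of an equilateral triangle, then so
is the angle before it at `p`, and conversely. -/
lemma Gap.triangle_iff {v p u w w' : ℂ} {g h : ℝ} (hv : Gap S v u g w)
    (hp : Gap S p w' h (-u)) (hpv : p = v + u) : g = π / 3 ↔ h = π / 3 := by
  have hc := cis_neg_pi_div_three
  constructor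
  · intro hg
    by_contra hne
    have hlt : π / 3 < h := lt_of_le_of_ne hp.le (Ne.symm hne)
    refine hp.empty (h - π / 3) (by linarith) (by linarith [pi_pos]) ?_
    have : p + w' * cis (h - π / 3) = v + w := by
      rw [sub_eq_add_neg, cis_add, ← mul_assoc, ← hp.eq, hv.eq, hg, hpv, hc]
      ring
    rw [this]
    exact hv.right
  · intro hh
    by_contra hne
    have hlt : π / 3 < g := lt_of_le_of_ne hv.le (Ne.symm hne)
    refine hv.empty (π / 3) (by positivity) hlt ?_
    have : v + u * cis (π / 3) = p + w' := by
      rw [hp.left_eq, hh, hpv, hc]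
      ring
    rw [this]
    exact hp.left

/-- On either side of a unit edge, the two angles sum to at least `π`, unless they belong to an
equilateral triangle. -/
lemma Gap.pi_le_add (hS : Separated S) {v p u w w' : ℂ} {g h : ℝ} (hv : Gap S v u g w)
    (hp : Gap S p w' h (-u)) (hpv : p = v + u) (hg : g ≠ π / 3) : π ≤ g + h := by
  by_contra! hlt
  have hg0 := hv.pos
  have hh0 := hp.pos
  have key : (v + w) - (p + w') = u * (cis g + cis (-h) - 1) := by
    rw [hp.left_eq, hpv, hv.eq]
    ring
  have hsq : ‖(v + w) - (p + w')‖ ^ 2 = 3 + 2 * cos (g + h) - 2 * cos g - 2 * cos h := by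
    rw [key, norm_mul, hv.norm_left, one_mul, ← Complex.normSq_eq_norm_sq, Complex.normSq_apply]
    simp only [Complex.add_re, Complex.sub_re, Complex.add_im, Complex.sub_im, cis_re, cis_im,
      cos_neg, sin_neg, Complex.one_re, Complex.one_im, cos_add]
    linear_combination sin_sq_add_cos_sq g + sin_sq_add_cos_sq h
  by_cases hne : v + w = p + w'
  · rw [hne, sub_self] at key
    have hu : u ≠ 0 := by
      rintro rfl
      simpa using hv.norm_left
    have hz : cis g + cis (-h) - 1 = 0 := by
      rcases mul_eq_zero.1 key.symm with h0 | h0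
      · exact absurd h0 hu
      · exact h0
    have hre := congrArg Complex.re hz
    have him := congrArg Complex.im hz
    simp only [Complex.add_re, Complex.sub_re, Complex.add_im, Complex.sub_im, cis_re, cis_im,
      cos_neg, sin_neg, Complex.one_re, Complex.one_im, Complex.zero_re, Complex.zero_im] at hre him
    have hcos : cos g = cos (π / 3) := by
      rw [cos_pi_div_three]
      have h1 := sin_sq_add_cos_sq g
      have h2 := sin_sq_add_cos_sq h
      have h3 : sin g = sin h := by linarith
      have h4 : cos h = 1 - cos g := by linarith
      rw [h4, ← h3] at h2
      linarith
    exact hg (injOn_cos ⟨hg0.le, by linarith⟩ ⟨by positivity, by linarith [pi_pos]⟩ hcos)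
  · have h1 := hS _ hv.right _ hp.left hne
    have h2 : 1 ≤ 3 + 2 * cos (g + h) - 2 * cos g - 2 * cos h := by
      rw [← hsq]
      nlinarith
    have e1 : cos (g + h) = 2 * cos ((g + h) / 2) ^ 2 - 1 := by
      rw [← cos_two_mul]
      ring_nf
    have e2 : cos g + cos h = 2 * cos ((g + h) / 2) * cos ((g - h) / 2) := cos_add_cos g h
    have hs : 0 < cos ((g + h) / 2) := cos_pos_of_mem_Ioo ⟨by linarith, by linarith⟩
    have hd : cos ((g + h) / 2) < cos ((g - h) / 2) := by
      rw [← cos_abs ((g - h) / 2)]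
      refine cos_lt_cos_of_nonneg_of_le_pi (abs_nonneg _) (by linarith) ?_
      rw [abs_lt]
      constructor <;> linarith
    nlinarith

/-- Three consecutive equilateral triangles would give three collinear points. -/
lemma Fan.not_three_triangles {n : ℕ} [NeZero n] (hC : NoCollinear S) {v : ℂ} {d : Fin n → ℂ}
    {g : Fin n → ℝ} (F : Fan S v d g) (i : Fin n) (h0 : g i = π / 3) (h1 : g (i + 1) = π / 3)
    (h2 : g (i + 1 + 1) = π / 3) : False := by
  have e0 := (F.gap i).eq
  have e1 := (F.gap (i + 1)).eq
  have e2 := (F.gap (i + 1 + 1)).eq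
  have hd : d (i + 1 + 1 + 1) = -d i := by
    rw [e2, e1, e0, h0, h1, h2, mul_assoc, mul_assoc, ← cis_add, ← cis_add]
    ring_nf
    simp
  have hm := (F.gap (i + 1 + 1)).right
  rw [hd] at hm
  have hne : d i ≠ 0 := by
    intro h
    simpa [h] using (F.gap i).norm_left
  refine hC v F.mem (d i) (-d i) (F.gap i).left hm hne (neg_ne_zero.2 hne) ?_ ?_
  · exact fun h => hne (CharZero.eq_neg_self_iff.1 h)
  · rw [map_neg, mul_neg, Complex.mul_conj]
    simp

end Local

section Existence

variable {S : Set ℂ}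

lemma Separated.pi_div_three_le (hS : Separated S) {v u : ℂ} {x y : ℝ} (hu : ‖u‖ = 1)
    (hx : v + u * cis x ∈ S) (hy : v + u * cis y ∈ S) (hxy : x < y) :
    π / 3 ≤ y - x := by
  by_contra! hlt
  have hcos : 1 / 2 < cos (y - x) := by
    rw [← cos_pi_div_three]
    exact cos_lt_cos_of_nonneg_of_le_pi (by linarith) (by linarith [pi_pos]) hlt
  have hcos' : cos (y - x) < 1 := by
    rw [← cos_zero]
    exact cos_lt_cos_of_nonneg_of_le_pi le_rfl (by linarith [pi_pos]) (by linarith)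
  have key : (v + u * cis y) - (v + u * cis x) = u * cis x * (cis (y - x) - 1) := by
    rw [mul_sub, mul_assoc u (cis x) (cis (y - x)), ← cis_add]
    ring_nf
  have hsq : ‖(v + u * cis y) - (v + u * cis x)‖ ^ 2 = 2 - 2 * cos (y - x) := by
    rw [key, norm_mul, norm_mul, hu, norm_cis, one_mul, one_mul, ← Complex.normSq_eq_norm_sq,
      normSq_cis_sub_one]
  have hne : v + u * cis y ≠ v + u * cis x := by
    intro h
    rw [h, sub_self, norm_zero] at hsq
    linarith
  have := hS _ hy _ hx hne
  nlinarith

/-- The neighbours of a point with `m + 1` unit neighbours can be listed in counterclockwise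
order, starting at any of them. -/
lemma hasFans_of_ncard (hS : Separated S) {v : ℂ} (hv : v ∈ S) {m : ℕ}
    (hcard : {u : ℂ | ‖u‖ = 1 ∧ v + u ∈ S}.ncard = m + 1) : HasFans (m + 1) S v := by
  intro u hu huS
  have hu0 : u ≠ 0 := by
    rintro rfl
    simp at hu
  set Θ : Set ℝ := {θ | θ ∈ Set.Ico 0 (2 * π) ∧ v + u * cis θ ∈ S} with hΘ
  have himg : (fun θ => u * cis θ) '' Θ = {u : ℂ | ‖u‖ = 1 ∧ v + u ∈ S} := by
    ext z
    constructor
    · rintro ⟨θ, ⟨-, hθ⟩, rfl⟩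
      exact ⟨by rw [norm_mul, hu, norm_cis, one_mul], hθ⟩
    · rintro ⟨hz, hzS⟩
      obtain ⟨θ, h0, h1, h2⟩ := exists_cis_eq (z := z / u) (by rw [norm_div, hz, hu, div_one])
      have h3 : u * cis θ = z := by
        rw [h2]
        field_simp
      exact ⟨θ, ⟨⟨h0, h1⟩, by rwa [h3]⟩, h3⟩
  have hinj : Set.InjOn (fun θ => u * cis θ) Θ := by
    intro x hx y hy h
    exact cis_injOn hx.1 hy.1 (mul_left_cancel₀ hu0 h)
  have hΘcard : Θ.ncard = m + 1 := by
    rw [← hcard, ← himg, hinj.ncard_image]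
  have hfin : Θ.Finite := Set.finite_of_ncard_ne_zero (by omega)
  have hscard : hfin.toFinset.card = m + 1 := by
    rw [← Set.ncard_eq_toFinset_card Θ hfin, hΘcard]
  set f := hfin.toFinset.orderEmbOfFin hscard with hf
  have hfmem : ∀ i, f i ∈ Θ := fun i =>
    hfin.mem_toFinset.1 (Finset.orderEmbOfFin_mem hfin.toFinset hscard i)
  have hsurj : ∀ θ ∈ Θ, ∃ i, f i = θ := by
    intro θ hθ
    have : θ ∈ Set.range f := by
      rw [hf, Finset.range_orderEmbOfFin]
      simpa using hθ
    exact this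
  have h0Θ : (0 : ℝ) ∈ Θ := ⟨⟨le_rfl, by positivity⟩, by simpa using huS⟩
  have hf0 : f 0 = 0 := by
    obtain ⟨j, hj⟩ := hsurj 0 h0Θ
    refine le_antisymm ?_ (hfmem 0).1.1
    rw [← hj]
    exact f.monotone (Fin.zero_le j)
  refine ⟨fun i => u * cis (f i), fun i => f (i + 1) - f i + if i = Fin.last m then 2 * π else 0,
    ⟨hv, fun i => ?_, ?_⟩, by simp [hf0]⟩
  · have hun : ‖u * cis (f i)‖ = 1 := by rw [norm_mul, hu, norm_cis, one_mul]
    by_cases hi : i = Fin.last m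
    · have hi1 : i + 1 = 0 := by
        rw [hi]
        simp
      have hg : f (i + 1) - f i + (if i = Fin.last m then 2 * π else 0) = 2 * π - f i := by
        rw [if_pos hi, hi1, hf0]
        ring
      refine ⟨hun, (hfmem _).2, (hfmem _).2, ?_, ?_, ?_⟩
      · simp only [hg]
        rw [hi1, hf0, mul_assoc, ← cis_add]
        simp
      · rw [hg]
        rcases (hfmem i).1.1.eq_or_lt with h | h
        · rw [← h]
          linarith [pi_pos]
        · exact hS.pi_div_three_le hu (hfmem i).2 (by simpa using huS) (hfmem i).1.2
      · intro φ hφ hφg hmem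
        rw [hg] at hφg
        rw [mul_assoc, ← cis_add] at hmem
        obtain ⟨j, hj⟩ := hsurj (f i + φ) ⟨⟨by linarith [(hfmem i).1.1], by linarith⟩, hmem⟩
        have : f i < f j := by linarith
        rw [f.lt_iff_lt, hi] at this
        exact absurd (Fin.le_last j) (not_le.2 this)
    · have hg : f (i + 1) - f i + (if i = Fin.last m then 2 * π else 0) = f (i + 1) - f i := by
        rw [if_neg hi, add_zero]
      have hlt : i < i + 1 := by
        rw [Fin.lt_add_one_iff]
        exact lt_of_le_of_ne (Fin.le_last i) hi
      refine ⟨hun, (hfmem _).2, (hfmem _).2, ?_, ?_, ?_⟩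
      · simp only [hg]
        rw [mul_assoc, ← cis_add]
        ring_nf
      · rw [hg]
        exact hS.pi_div_three_le hu (hfmem i).2 (hfmem _).2 (f.lt_iff_lt.2 hlt)
      · intro φ hφ hφg hmem
        rw [hg] at hφg
        rw [mul_assoc, ← cis_add] at hmem
        obtain ⟨j, hj⟩ := hsurj (f i + φ)
          ⟨⟨by linarith [(hfmem i).1.1], by linarith [(hfmem (i + 1)).1.2]⟩, hmem⟩
        have h1 : f i < f j := by linarith
        have h2 : f j < f (i + 1) := by linarith
        rw [f.lt_iff_lt] at h1 h2
        exact absurd (Fin.add_one_le_of_lt h1) (not_le.2 h2)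
  · rw [Finset.sum_add_distrib, Finset.sum_sub_distrib,
      Fintype.sum_equiv (Equiv.addRight (1 : Fin (m + 1))) (fun i => f (i + 1)) f (fun i => rfl)]
    simp

/-- A point has at most five unit neighbours. -/
lemma ncard_le_five (hS : Separated S) (hC : NoCollinear S) {v : ℂ} (hv : v ∈ S) :
    {u : ℂ | ‖u‖ = 1 ∧ v + u ∈ S}.ncard ≤ 5 := by
  by_contra! hlt
  obtain ⟨m, hm⟩ : ∃ m, {u : ℂ | ‖u‖ = 1 ∧ v + u ∈ S}.ncard = m + 1 :=
    ⟨_, (Nat.succ_pred (by omega)).symm⟩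
  have hne : {u : ℂ | ‖u‖ = 1 ∧ v + u ∈ S}.Nonempty := by
    apply Set.nonempty_of_ncard_ne_zero
    omega
  obtain ⟨u, hu, huS⟩ := hne
  obtain ⟨d, g, F, -⟩ := hasFans_of_ncard hS hv hm u hu huS
  have hm5 : (5 : ℝ) ≤ m := by exact_mod_cast (by omega : 5 ≤ m)
  have hall : ∀ i, g i = π / 3 := by
    intro i
    have h1 : ∑ j, (g j - π / 3) = 2 * π - (m + 1) * (π / 3) := by
      rw [Finset.sum_sub_distrib, F.sum]
      simp
    have h2 : g i - π / 3 ≤ ∑ j, (g j - π / 3) :=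
      Finset.single_le_sum (f := fun j => g j - π / 3) (fun j _ => by linarith [(F.gap j).le])
        (Finset.mem_univ i)
    have h3 := (F.gap i).le
    nlinarith [pi_pos]
  exact F.not_three_triangles hC 0 (hall _) (hall _) (hall _)

end Existence

section Degree

variable {S : Set ℂ}

lemma Fan.rotate {n : ℕ} [NeZero n] {v : ℂ} {d : Fin n → ℂ} {g : Fin n → ℝ} (F : Fan S v d g)
    (k : Fin n) : Fan S v (fun i => d (i + k)) (fun i => g (i + k)) where
  mem := F.mem
  gap i := by
    have := F.gap (i + k)
    rwa [add_right_comm] at this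
  sum := by
    rw [← F.sum]
    exact Fintype.sum_equiv (Equiv.addRight k) _ _ (fun i => rfl)

lemma HasFans.exists_fan_neg {n : ℕ} [NeZero n] {v u : ℂ} (h : HasFans n S (v + u)) (hv : v ∈ S)
    (hu : ‖u‖ = 1) : ∃ e k, Fan (n := n) S (v + u) e k ∧ e 0 = -u :=
  h (-u) (by rwa [norm_neg]) (by rwa [add_neg_cancel_right])

lemma Fan.gap_of_add_one {n : ℕ} [NeZero n] {v : ℂ} {d : Fin n → ℂ} {g : Fin n → ℝ}
    (F : Fan S v d g) (i : Fin n) {j : Fin n} {u : ℂ} (hj : i + 1 = j) (hu : d j = u) :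
    Gap S v (d i) (g i) u := by
  subst hj hu
  exact F.gap i

/-- The two angles on the same side of a unit edge. -/
lemma Fan.edge {m n : ℕ} [NeZero m] [NeZero n] (hS : Separated S) {v p : ℂ}
    {d : Fin m → ℂ} {g : Fin m → ℝ} {e : Fin n → ℂ} {h : Fin n → ℝ} (F : Fan S v d g)
    (F' : Fan S p e h) (i : Fin m) (j : Fin n) (hp : p = v + d i) (he : e (j + 1) = -d i) :
    (g i = π / 3 ↔ h j = π / 3) ∧ (g i ≠ π / 3 → π ≤ g i + h j) :=
  ⟨(F.gap i).triangle_iff (F'.gap_of_add_one j rfl he) hp,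
    (F.gap i).pi_le_add hS (F'.gap_of_add_one j rfl he) hp⟩

lemma Fan.pi_lt_add {n : ℕ} [NeZero n] (hC : NoCollinear S) {v : ℂ} {d : Fin n → ℂ}
    {g : Fin n → ℝ} (F : Fan S v d g) (i : Fin n) : π < g i + g (i + 1) + g (i + 1 + 1) := by
  have h0 := (F.gap i).le
  have h1 := (F.gap (i + 1)).le
  have h2 := (F.gap (i + 1 + 1)).le
  by_contra! hle
  exact F.not_three_triangles hC i (by linarith) (by linarith) (by linarith)

lemma Fan.sum_five {v : ℂ} {d : Fin 5 → ℂ} {g : Fin 5 → ℝ} (F : Fan S v d g) :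
    g 0 + g 1 + g 2 + g 3 + g 4 = 2 * π := by
  rw [← F.sum, Fin.sum_univ_five]

lemma Fan.triangle_zero_or_four (hS : Separated S) (hC : NoCollinear S) {v : ℂ}
    {d : Fin 5 → ℂ} {g : Fin 5 → ℝ} (F : Fan S v d g) (hp : HasFans 5 S (v + d 0)) :
    g 0 = π / 3 ∨ g 4 = π / 3 := by
  obtain ⟨e, h, F', he⟩ := hp.exists_fan_neg F.mem (F.gap 0).norm_left
  by_contra! hne
  have h1 := (F.edge hS F' 0 4 rfl he).2 hne.1
  have h2 := F'.edge hS F 0 4 (by rw [he]; ring) (by rw [he, neg_neg]; rfl)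
  have h3 := h2.2 (fun h => hne.2 (h2.1.1 h))
  have h4 : π < g 1 + g 2 + g 3 := F.pi_lt_add hC 1
  have h5 : π < h 1 + h 2 + h 3 := F'.pi_lt_add hC 1
  linarith [F.sum_five, F'.sum_five]

/-- An edge between two points of degree five lies on an equilateral triangle. -/
lemma Fan.triangle_or_triangle (hS : Separated S) (hC : NoCollinear S) {v : ℂ}
    {d : Fin 5 → ℂ} {g : Fin 5 → ℝ} (F : Fan S v d g) (i : Fin 5) (hp : HasFans 5 S (v + d i)) :
    g i = π / 3 ∨ g (i + 4) = π / 3 := by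
  have := (F.rotate i).triangle_zero_or_four hS hC (by simpa using hp)
  simpa [add_comm] using this

lemma NoCollinear.im_ne_zero (hC : NoCollinear S) {p u x y : ℂ} (hp : p ∈ S) (hu : ‖u‖ = 1)
    (hx : p + u * x ∈ S) (hy : p + u * y ∈ S) (hx0 : x ≠ 0) (hy0 : y ≠ 0) (hxy : x ≠ y) :
    (x * conj y).im ≠ 0 := by
  have hu0 : u ≠ 0 := by
    rintro rfl
    simp at hu
  have := hC p hp _ _ hx hy (mul_ne_zero hu0 hx0) (mul_ne_zero hu0 hy0)
    (fun h => hxy (mul_left_cancel₀ hu0 h))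
  have huu : u * conj u = 1 := by
    rw [Complex.mul_conj, Complex.normSq_eq_norm_sq, hu]
    simp
  have key : u * x * conj (u * y) = x * conj y := by
    rw [map_mul]
    linear_combination x * conj y * huu
  rwa [key] at this

/-- Two adjacent equilateral triangles cannot have all four vertices of degree five. -/
lemma Fan.not_kernel (hS : Separated S) (hC : NoCollinear S) {v : ℂ} {d : Fin 5 → ℂ}
    {g : Fin 5 → ℝ} (F : Fan S v d g) (h0 : HasFans 5 S (v + d 0)) (h1 : HasFans 5 S (v + d 1))
    (h2 : HasFans 5 S (v + d 2)) (hg0 : g 0 = π / 3) (hg1 : g 1 = π / 3) : False := by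
  obtain ⟨f, k, FD, hf⟩ := h0.exists_fan_neg F.mem (F.gap 0).norm_left
  obtain ⟨q, r, FR, hq⟩ := h1.exists_fan_neg F.mem (F.gap 1).norm_left
  obtain ⟨e, h, FU, he⟩ := h2.exists_fan_neg F.mem (F.gap 2).norm_left
  have hz := cis_pi_div_three_sq
  have hz' := cis_neg_pi_div_three
  have hd1 : d 1 = d 0 * cis (π / 3) := by rw [← hg0]; exact (F.gap 0).eq
  have hd2 : d 2 = d 1 * cis (π / 3) := by rw [← hg1]; exact (F.gap 1).eq
  have hk4 : k 4 = π / 3 := (F.edge hS FD 0 4 rfl hf).1.1 hg0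
  have hr4 : r 4 = π / 3 := (F.edge hS FR 1 4 rfl hq).1.1 hg1
  have hr0 : r 0 = π / 3 := (FR.edge hS F 0 0 (by rw [hq]; ring) (by rw [hq, neg_neg]; rfl)).1.2 hg0
  have hh0 : h 0 = π / 3 := (FU.edge hS F 0 1 (by rw [he]; ring) (by rw [he, neg_neg]; rfl)).1.2 hg1
  have he1 : e 1 = -d 2 * cis (π / 3) := by rw [← hh0, ← he]; exact (FU.gap 0).eq
  have hq1 : q 1 = -d 1 * cis (π / 3) := by rw [← hr0, ← hq]; exact (FR.gap 0).eq
  have hq4 : q 4 = -d 1 * cis (-(π / 3)) := by rw [← hr4, ← hq]; exact (FR.gap 4).left_eq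
  have hf4 : f 4 = -d 0 * cis (-(π / 3)) := by rw [← hk4, ← hf]; exact (FD.gap 4).left_eq
  have eLU := F.edge hS FU 2 4 rfl he
  have eDL := FD.edge hS F 0 4 (by rw [hf]; ring) (by rw [hf, neg_neg]; rfl)
  have eUR := FU.edge hS FR 1 3 (by rw [he1, hd2]; linear_combination d 1 * hz)
    (by
      change q 4 = _
      rw [hq4, hz', he1, hd2]
      linear_combination (-d 1) * hz)
  have eRD := FR.edge hS FD 1 3 (by rw [hq1, hd1]; linear_combination d 0 * hz)
    (by
      change f 4 = _
      rw [hf4, hz', hq1, hd1]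
      linear_combination (-d 0) * hz)
  have hg2 : g 2 ≠ π / 3 := fun h => F.not_three_triangles hC 0 hg0 hg1 h
  have hk0 : k 0 ≠ π / 3 := fun h => F.not_three_triangles hC 4 (eDL.1.1 h) hg0 hg1
  have hh1 : h 1 ≠ π / 3 := fun h => FR.not_three_triangles hC 3 (eUR.1.1 h) hr4 hr0
  have hr1 : r 1 ≠ π / 3 := fun h => FR.not_three_triangles hC 4 hr4 hr0 h
  have i1 := eLU.2 hg2
  have i2 := eDL.2 hk0
  have i3 := eUR.2 hh1
  have i4 := eRD.2 hr1
  have sF := F.sum_five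
  have sD := FD.sum_five
  have sR := FR.sum_five
  have sU := FU.sum_five
  have lF := (F.gap 3).le
  have lR := (FR.gap 2).le
  have lU2 := (FU.gap 2).le
  have lU3 := (FU.gap 3).le
  have lD1 := (FD.gap 1).le
  have lD2 := (FD.gap 2).le
  have hh3 : h 3 = π / 3 := by linarith
  have hh4 : h 4 = π - g 2 := by linarith
  have hk0' : k 0 = g 2 := by linarith
  have lF2 := (F.gap 2).pos
  have lF4 := (F.gap 4).pos
  have hsin : 0 < (cis (g 2)).im := by
    rw [cis_im]
    exact sin_pos_of_pos_of_lt_pi lF2 (by linarith)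
  have he4 : e 4 = -d 2 * cis (-(π - g 2)) := by rw [← hh4, ← he]; exact (FU.gap 4).left_eq
  have he3 : e 3 = e 4 * cis (-(π / 3)) := by rw [← hh3]; exact (FU.gap 3).left_eq
  have hf1 : f 1 = -d 0 * cis (g 2) := by rw [← hk0', ← hf]; exact (FD.gap 0).eq
  have hc : cis (-(π - g 2)) = -cis (g 2) := by
    rw [show -(π - g 2) = g 2 + π - 2 * π by ring, sub_eq_add_neg, cis_add, cis_add, cis_pi]
    have := cis_mul_cis_neg (2 * π)
    rw [cis_two_pi, one_mul] at this
    rw [this]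
    ring
  set z := cis (π / 3) with hzdef
  set E := cis (g 2) with hE
  have hzre : z.re = 1 / 2 := by rw [hzdef, cis_re, cos_pi_div_three]
  have hzim : 0 < z.im := by
    rw [hzdef, cis_im, sin_pi_div_three]
    positivity
  have hEE : E.re ^ 2 + E.im ^ 2 = 1 := by
    rw [hE, cis_re, cis_im, cos_sq_add_sin_sq]
  refine hC.im_ne_zero F.mem (F.gap 0).norm_left (x := z - 1 + E * z) (y := 1 - E) ?_ ?_ ?_ ?_ ?_ ?_
  · convert (FU.gap 3).left using 1
    rw [he3, he4, hc, hz', hd2, hd1]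
    linear_combination d 0 * (E * z - 1) * hz
  · convert (FD.gap 0).right using 1
    change _ = v + d 0 + f 1
    rw [hf1]
    ring
  · intro h
    have h' : z * (z + E) = 0 := by linear_combination h + hz
    rcases mul_eq_zero.1 h' with h3 | h3
    · rw [h3] at hzre
      norm_num at hzre
    · have := congrArg Complex.im h3
      rw [Complex.add_im, Complex.zero_im] at this
      linarith
  · intro h
    have := congrArg Complex.im h
    rw [Complex.sub_im, Complex.zero_im, Complex.one_im] at this
    linarith
  · intro h
    have h' : (1 + z) * (E - 1 + z) = 0 := by linear_combination h + hz
    rcases mul_eq_zero.1 h' with h3 | h3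
    · have := congrArg Complex.im h3
      rw [Complex.add_im, Complex.zero_im, Complex.one_im] at this
      linarith
    · have := congrArg Complex.im h3
      rw [Complex.add_im, Complex.sub_im, Complex.zero_im, Complex.one_im] at this
      linarith
  · simp only [Complex.mul_im, Complex.add_re, Complex.add_im, Complex.sub_re, Complex.sub_im,
      Complex.one_re, Complex.one_im, Complex.conj_re, Complex.conj_im, Complex.mul_re, hzre]
    linear_combination (-z.im) * hEE

lemma Fan.not_two_triangles (hS : Separated S) (hC : NoCollinear S) {v : ℂ} {d : Fin 5 → ℂ}
    {g : Fin 5 → ℝ} (F : Fan S v d g) (i : Fin 5) (h0 : HasFans 5 S (v + d i))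
    (h1 : HasFans 5 S (v + d (i + 1))) (h2 : HasFans 5 S (v + d (i + 1 + 1)))
    (hg0 : g i = π / 3) (hg1 : g (i + 1) = π / 3) : False := by
  refine (F.rotate i).not_kernel hS hC (by simpa using h0) ?_ ?_ (by simpa using hg0) ?_
  · simpa [add_comm] using h1
  · have h : ∀ i : Fin 5, 2 + i = i + 1 + 1 := by decide
    simpa only [h] using h2
  · simpa [add_comm] using hg1

end Degree

section Pentagon

lemma sin_sq_add_sin_sq_le {A B : ℝ} (hA : π / 6 ≤ A) (hB : π / 6 ≤ B)
    (hAB : A + B ≤ 5 * π / 6) :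
    sin A ^ 2 + sin B ^ 2 - 2 * sin A * sin B * cos (2 * π / 3 - A - B) ≤ 1 / 4 := by
  have e1 : sin A ^ 2 + sin B ^ 2 = 1 - cos (A + B) * cos (A - B) := by
    rw [cos_add, cos_sub]
    linear_combination (1 - sin B ^ 2) * sin_sq_add_cos_sq A +
      (cos A ^ 2) * sin_sq_add_cos_sq B
  have e2 : 2 * sin A * sin B = cos (A - B) - cos (A + B) := by
    rw [cos_add, cos_sub]
    ring
  have e3 : cos (A + B) + cos (2 * π / 3 - A - B) = cos (A + B - π / 3) := by
    rw [show 2 * π / 3 - A - B = -((A + B - π / 3) - π / 3) by ring, cos_neg,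
      cos_sub (A + B - π / 3), show cos (A + B) = cos ((A + B - π / 3) + π / 3) by ring_nf,
      cos_add (A + B - π / 3), cos_pi_div_three]
    ring
  have e4 : cos (A + B) * cos (2 * π / 3 - A - B) = cos (A + B - π / 3) ^ 2 - 3 / 4 := by
    rw [show 2 * π / 3 - A - B = -((A + B - π / 3) - π / 3) by ring, cos_neg,
      cos_sub (A + B - π / 3), show cos (A + B) = cos ((A + B - π / 3) + π / 3) by ring_nf,
      cos_add (A + B - π / 3), cos_pi_div_three, sin_pi_div_three]
    have h3 : √3 ^ 2 = 3 := sq_sqrt (by norm_num)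
    linear_combination -(sin (A + B - π / 3) ^ 2 / 4) * h3 -
      3 / 4 * sin_sq_add_cos_sq (A + B - π / 3)
  have h0 : 0 ≤ cos (A + B - π / 3) :=
    cos_nonneg_of_neg_pi_div_two_le_of_le (by linarith [pi_pos]) (by linarith)
  have h1 : cos (A + B - π / 3) ≤ cos (A - B) := by
    rw [← cos_abs (A - B)]
    refine cos_le_cos_of_nonneg_of_le_pi (abs_nonneg _) (by linarith [pi_pos]) ?_
    rw [abs_le]
    constructor <;> linarith
  rw [e1, e2, ← e3] at *
  nlinarith

lemma norm_sq_cis_combination (A σ η : ℝ) :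
    ‖1 - cis (-(σ - A - η)) - cis (2 * A) + cis (2 * A + (σ - A + η))‖ ^ 2 =
      4 * (sin A ^ 2 + sin σ ^ 2 - 2 * sin A * sin σ * cos η) := by
  have key : 1 - cis (-(σ - A - η)) - cis (2 * A) + cis (2 * A + (σ - A + η)) =
      cis A * (cis (-A) - cis A + cis η * (cis σ - cis (-σ))) := by
    have h1 : cis (-(σ - A - η)) = cis A * (cis η * cis (-σ)) := by
      rw [← cis_add, ← cis_add]
      ring_nf
    have h2 : cis (2 * A) = cis A * cis A := by
      rw [← cis_add]
      ring_nf
    have h3 : cis (2 * A + (σ - A + η)) = cis A * (cis η * cis σ) := by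
      rw [← cis_add, ← cis_add]
      ring_nf
    rw [h1, h2, h3]
    linear_combination -cis_mul_cis_neg A
  rw [key, norm_mul, norm_cis, one_mul, ← Complex.normSq_eq_norm_sq, Complex.normSq_apply]
  simp only [Complex.add_re, Complex.sub_re, Complex.add_im, Complex.sub_im, Complex.mul_re,
    Complex.mul_im, cis_re, cis_im, cos_neg, sin_neg]
  linear_combination 4 * sin σ ^ 2 * sin_sq_add_cos_sq η

/-- Two edges turning away from the two sides of an angle `α` by `g` and `g'` end at points closer
than one when the total turn is at most `5 * π / 3`. -/
lemma norm_sub_lt_one {a : ℂ} {α g g' : ℝ} (ha : ‖a‖ = 1) (hα : π / 3 < α) (hg : π / 3 < g)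
    (hg' : π / 3 < g') (h : α + g + g' ≤ 5 * π / 3) :
    ‖(a + -a * cis (-g)) - (a * cis α + -(a * cis α) * cis g')‖ < 1 := by
  have key : (a + -a * cis (-g)) - (a * cis α + -(a * cis α) * cis g') =
      a * (1 - cis (-g) - cis α + cis (α + g')) := by
    rw [cis_add]
    ring
  have hsq := norm_sq_cis_combination (α / 2) ((α + g + g') / 2) ((g' - g) / 2)
  rw [show -((α + g + g') / 2 - α / 2 - (g' - g) / 2) = -g by ring,
    show 2 * (α / 2) = α by ring,
    show (α + g + g') / 2 - α / 2 + (g' - g) / 2 = g' by ring] at hsq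
  have hle := sin_sq_add_sin_sq_le (A := α / 2) (B := π - (α + g + g') / 2) (by linarith)
    (by linarith) (by linarith)
  rw [sin_pi_sub, show 2 * π / 3 - α / 2 - (π - (α + g + g') / 2) = (g + g') / 2 - π / 3 by ring]
    at hle
  have hcos : cos ((g + g') / 2 - π / 3) < cos ((g' - g) / 2) := by
    rw [← cos_abs ((g' - g) / 2)]
    refine cos_lt_cos_of_nonneg_of_le_pi (abs_nonneg _) (by linarith) ?_
    rw [abs_lt]
    constructor <;> linarith
  have h1 : 0 < sin (α / 2) := sin_pos_of_pos_of_lt_pi (by linarith [pi_pos]) (by linarith)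
  have h2 : 0 < sin ((α + g + g') / 2) :=
    sin_pos_of_pos_of_lt_pi (by linarith [pi_pos]) (by linarith [pi_pos])
  rw [key, norm_mul, ha, one_mul]
  have h3 := mul_lt_mul_of_pos_left hcos (mul_pos h1 h2)
  nlinarith [norm_nonneg (1 - cis (-g) - cis α + cis (α + g'))]

end Pentagon

section Mirror

variable {S : Set ℂ}

lemma Separated.mirror (hS : Separated S) : Separated {z | conj z ∈ S} := by
  intro p hp q hq hne
  have := hS _ hp _ hq (fun h => hne ((starRingEnd ℂ).injective h))
  rwa [← map_sub, Complex.norm_conj] at this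

lemma NoCollinear.mirror (hC : NoCollinear S) : NoCollinear {z | conj z ∈ S} := by
  intro p hp a b ha hb ha0 hb0 hab h
  have h0 : ∀ x : ℂ, x ≠ 0 → conj x ≠ 0 := fun x hx => by simpa using hx
  refine hC _ hp (conj a) (conj b) (by rw [← map_add]; exact ha) (by rw [← map_add]; exact hb)
    (h0 a ha0) (h0 b hb0) (fun h => hab ((starRingEnd ℂ).injective h)) ?_
  rw [← map_mul, Complex.conj_im, h, neg_zero]

lemma Gap.mirror {v u w : ℂ} {g : ℝ} (h : Gap S v u g w) :
    Gap {z | conj z ∈ S} (conj v) (conj w) g (conj u) where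
  norm_left := by rw [Complex.norm_conj, h.norm_right]
  left := by simpa using h.right
  right := by simpa using h.left
  eq := by rw [h.left_eq, map_mul, conj_cis, neg_neg]
  le := h.le
  empty φ h0 h1 hm := by
    refine h.empty (g - φ) (by linarith) (by linarith) ?_
    have : conj (conj v + conj w * cis φ) = v + u * cis (g - φ) := by
      rw [sub_eq_add_neg, cis_add, ← mul_assoc, ← h.eq]
      simp [conj_cis]
    rw [← this]
    exact hm

lemma Fan.mirror {n : ℕ} [NeZero n] {v : ℂ} {d : Fin n → ℂ} {g : Fin n → ℝ} (F : Fan S v d g) :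
    Fan {z | conj z ∈ S} (conj v) (fun i => conj (d (-i))) (fun i => g (-i - 1)) where
  mem := by simpa using F.mem
  gap i := by
    have := (F.gap (-i - 1)).mirror
    rw [sub_add_cancel] at this
    convert this using 3
    abel
  sum := by
    rw [← F.sum]
    exact Fintype.sum_equiv ((Equiv.neg (Fin n)).trans (Equiv.subRight 1)) _ _ (fun i => rfl)

lemma HasFans.mirror {n : ℕ} [NeZero n] {v : ℂ} (h : HasFans n S v) :
    HasFans n {z | conj z ∈ S} (conj v) := by
  intro u hu hm
  have hm' : v + conj u ∈ S := by simpa using hm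
  obtain ⟨d, g, F, hd⟩ := h (conj u) (by rwa [Complex.norm_conj]) hm'
  exact ⟨_, _, F.mirror, by simp [hd]⟩

end Mirror

section Quad

variable {S : Set ℂ}

lemma cis_neg_sub_pi (g : ℝ) : cis (g - π) = -cis g := by
  have h := cis_mul_cis_neg π
  rw [cis_pi] at h
  rw [sub_eq_add_neg, cis_add]
  linear_combination -cis g * h

/-- The configuration in which the rhombus `A, A + a, A + a + a', A + a'` is a face, seen from the
vertex `A + a`. -/
lemma Fan.not_rhombus_of_ne (hS : Separated S) (hC : NoCollinear S) {A a : ℂ} {d f : Fin 5 → ℂ}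
    {g k : Fin 5 → ℝ} (F : Fan S (A + a) d g) (ha : ‖a‖ = 1) (hd0 : d 0 = -a)
    (h3 : HasFans 5 S (A + a + d 3)) (hg1 : g 1 = π / 3) (hg2 : g 2 ≠ π / 3) (hg3 : g 3 = π / 3)
    (hd4 : d 4 = a * cis (π - g 4))
    (hg0 : g 0 ≠ π / 3 ∨ A + d 4 * cis (π / 3) ∈ S)
    (FH : Fan S (A + a + d 4) f k) (hf : f 0 = -d 4) (hk0 : k 0 = π / 3) (hk1 : k 1 ≠ π / 3)
    (hk4 : π - g 4 ≤ k 4) : False := by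
  obtain ⟨e, l, FL, he⟩ := h3.exists_fan_neg F.mem (F.gap 3).norm_left
  have hz := cis_pi_div_three_sq
  have hz' := cis_neg_pi_div_three
  have hd43 : d 4 = d 3 * cis (π / 3) := by rw [← hg3]; exact (F.gap 3).eq
  have hl4 : l 4 = π / 3 := (F.edge hS FL 3 4 rfl he).1.1 hg3
  have eBL := FL.edge hS F 0 2 (by rw [he]; ring) (by rw [he, neg_neg]; rfl)
  have he4 : e 4 = -d 3 * cis (-(π / 3)) := by rw [← hl4, ← he]; exact (FL.gap 4).left_eq
  have hf1 : f 1 = -d 4 * cis (π / 3) := by rw [← hk0, ← hf]; exact (FH.gap 0).eq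
  have eHL := FH.edge hS FL 1 3 (by rw [hf1, hd43]; linear_combination d 3 * hz) (by
    change e 4 = _
    rw [he4, hz', hf1, hd43]
    linear_combination -d 3 * hz)
  have i1 := eBL.2 (fun h => hg2 (eBL.1.1 h))
  have i2 := eHL.2 hk1
  have sF := F.sum_five
  have sL := FL.sum_five
  have sH := FH.sum_five
  have lL1 := (FL.gap 1).le
  have lL2 := (FL.gap 2).le
  have lH2 := (FH.gap 2).le
  have lH3 := (FH.gap 3).le
  have lF0 := (F.gap 0).le
  have hg0' : g 0 = π / 3 := by linarith
  have hmem := hg0.resolve_left (not_not.2 hg0')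
  have hl0 : l 0 = π - g 2 := by linarith
  have he1 : e 1 = d 2 := by
    have h1 : e 1 = -d 3 * cis (l 0) := by rw [← he]; exact (FL.gap 0).eq
    have h2 : d 2 = d 3 * cis (-g 2) := (F.gap 2).left_eq
    rw [h1, h2, hl0, show π - g 2 = -(g 2 - π) by ring, ← conj_cis, cis_neg_sub_pi, map_neg,
      conj_cis]
    ring
  have hm2 : A + a + (d 3 + d 2) ∈ S := by
    have := (FL.gap 0).right
    rwa [show e (0 + 1) = d 2 from he1, add_assoc] at this
  have hd1 : d 1 = -a * cis (π / 3) := by rw [← hg0', ← hd0]; exact (F.gap 0).eq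
  have hd2 : d 2 = d 1 * cis (π / 3) := by rw [← hg1]; exact (F.gap 1).eq
  have hd3 : d 3 = d 4 * cis (-(π / 3)) := by rw [← hg3]; exact (F.gap 3).left_eq
  have hsin : 0 < (cis (π - g 4)).im := by
    rw [cis_im]
    exact sin_pos_of_pos_of_lt_pi (by linarith [(F.gap 2).pos]) (by linarith [(F.gap 4).pos])
  set z := cis (π / 3) with hzdef
  set E := cis (π - g 4) with hE
  have hzre : z.re = 1 / 2 := by rw [hzdef, cis_re, cos_pi_div_three]
  have hzim : 0 < z.im := by
    rw [hzdef, cis_im, sin_pi_div_three]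
    positivity
  have hzz : z.im ^ 2 = 3 / 4 := by
    have h := sin_sq_add_cos_sq (π / 3)
    rw [← cis_im, ← cis_re, ← hzdef, hzre] at h
    linarith
  have hEE : E.re ^ 2 + E.im ^ 2 = 1 := by
    rw [hE, cis_re, cis_im, cos_sq_add_sin_sq]
  refine hC.im_ne_zero F.mem ha (x := (1 + E) * (1 - z)) (y := E * z - 1) ?_ ?_ ?_ ?_ ?_ ?_
  · convert hm2 using 2
    rw [hd3, hz', hd4, hd2, hd1]
    linear_combination a * hz
  · convert hmem using 1
    rw [hd4]
    ring
  · intro h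
    rcases mul_eq_zero.1 h with h3 | h3
    · have := congrArg Complex.im h3
      rw [Complex.add_im, Complex.zero_im, Complex.one_im] at this
      linarith
    · have := congrArg Complex.im h3
      rw [Complex.sub_im, Complex.zero_im, Complex.one_im] at this
      linarith
  · intro h
    have h' : z * (E - 1 + z) = 0 := by linear_combination h + hz
    rcases mul_eq_zero.1 h' with h3 | h3
    · rw [h3] at hzre
      norm_num at hzre
    · have := congrArg Complex.im h3
      rw [Complex.add_im, Complex.sub_im, Complex.zero_im, Complex.one_im] at this
      linarith
  · intro h
    have h' : (1 - 2 * z) * (E + z) = 0 := by linear_combination h - 2 * hz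
    rcases mul_eq_zero.1 h' with h3 | h3
    · have := congrArg Complex.im h3
      simp at this
      linarith
    · have := congrArg Complex.im h3
      rw [Complex.add_im, Complex.zero_im] at this
      linarith
  · simp only [Complex.mul_im, Complex.add_re, Complex.add_im, Complex.sub_re, Complex.sub_im,
      Complex.one_re, Complex.one_im, Complex.conj_re, Complex.conj_im, Complex.mul_re, hzre]
    linear_combination (-z.im) * hEE + E.im * hzz

/-- A point `v` of degree five with directions `d`, the first one of which is special, all its
neighbours in the other directions being of degree five. -/
structure PopularFan (S : Set ℂ) (v : ℂ) (d : Fin 5 → ℂ) (g : Fin 5 → ℝ) : Prop extends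
    Fan S v d g where
  hasFans : ∀ i, i ≠ 0 → HasFans 5 S (v + d i)

/-- Only four patterns of equilateral triangles are possible. -/
lemma PopularFan.cases (hS : Separated S) (hC : NoCollinear S) {v : ℂ} {d : Fin 5 → ℂ}
    {g : Fin 5 → ℝ} (F : PopularFan S v d g) :
    (g 0 = π / 3 ∧ g 1 ≠ π / 3 ∧ g 2 = π / 3 ∧ g 3 ≠ π / 3 ∧ g 4 = π / 3) ∨
    (g 1 = π / 3 ∧ g 2 ≠ π / 3 ∧ g 3 = π / 3 ∧ (g 0 ≠ π / 3 ∨ g 4 ≠ π / 3)) := by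
  have t1 : g 1 = π / 3 ∨ g 0 = π / 3 :=
    F.triangle_or_triangle hS hC 1 (F.hasFans 1 (by decide))
  have t2 : g 2 = π / 3 ∨ g 1 = π / 3 :=
    F.triangle_or_triangle hS hC 2 (F.hasFans 2 (by decide))
  have t3 : g 3 = π / 3 ∨ g 2 = π / 3 :=
    F.triangle_or_triangle hS hC 3 (F.hasFans 3 (by decide))
  have t4 : g 4 = π / 3 ∨ g 3 = π / 3 :=
    F.triangle_or_triangle hS hC 4 (F.hasFans 4 (by decide))
  have k1 : g 1 = π / 3 → g 2 = π / 3 → False :=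
    F.not_two_triangles hS hC 1 (F.hasFans _ (by decide)) (F.hasFans _ (by decide))
      (F.hasFans _ (by decide))
  have k2 : g 2 = π / 3 → g 3 = π / 3 → False :=
    F.not_two_triangles hS hC 2 (F.hasFans _ (by decide)) (F.hasFans _ (by decide))
      (F.hasFans _ (by decide))
  have n3 : g 3 = π / 3 → g 4 = π / 3 → g 0 = π / 3 → False :=
    F.not_three_triangles hC 3
  tauto

lemma mul_mul_eq_zero_of_norm_eq_one {x y z : ℂ} (hx : ‖x‖ = 1) (hy : ‖y‖ = 1) (hz : ‖z‖ = 1)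
    (h : ‖x + y + z‖ = 1) : (x + y) * (y + z) * (z + x) = 0 := by
  have key : ∀ w : ℂ, ‖w‖ = 1 → w * conj w = 1 := fun w hw => by
    rw [Complex.mul_conj, Complex.normSq_eq_norm_sq, hw]
    simp
  have h1 := key x hx
  have h2 := key y hy
  have h3 := key z hz
  have h4 := key _ h
  rw [map_add, map_add] at h4
  have h5 : (x + y + z) * (y * z + z * x + x * y) = x * y * z := by
    linear_combination (x * y * z) * h4 - (x + y + z) * y * z * h1 - (x + y + z) * z * x * h2
      - (x + y + z) * x * y * h3
  linear_combination h5

lemma eq_zero_of_cis_eq_one {x : ℝ} (h1 : -(2 * π) < x) (h2 : x < 2 * π) (h : cis x = 1) :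
    x = 0 := by
  rw [← cos_eq_one_iff_of_lt_of_lt h1 h2, ← cis_re, h, Complex.one_re]

/-- A face of the penny graph at `A` between two edges towards popular points is large. -/
lemma PopularFan.lt_add (hS : Separated S) (hC : NoCollinear S) {A a a' : ℂ} {α : ℝ}
    {d d' : Fin 5 → ℂ} {g g' : Fin 5 → ℝ} (F : PopularFan S (A + a) d g)
    (F' : PopularFan S (A + a') d' g') (hd : d 0 = -a) (hd' : d' 0 = -a') (ha : ‖a‖ = 1)
    (ha' : a' = a * cis α) (hα : π / 3 < α) (hg1 : g 1 = π / 3) (hg2 : g 2 ≠ π / 3)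
    (hg3 : g 3 = π / 3) (hg4 : g 4 ≠ π / 3) (hg0' : g' 0 ≠ π / 3) (hg1' : g' 1 = π / 3)
    (hg2' : g' 2 ≠ π / 3) (hg3' : g' 3 = π / 3) (hiff : g 0 = π / 3 ↔ g' 4 = π / 3) :
    5 * π / 3 < α + g 4 + g' 0 := by
  by_contra! hle
  have p4 : π / 3 < g 4 := lt_of_le_of_ne (F.gap 4).le (Ne.symm hg4)
  have p0 : π / 3 < g' 0 := lt_of_le_of_ne (F'.gap 0).le (Ne.symm hg0')
  have hd4 : d 4 = -a * cis (-g 4) := by rw [← hd]; exact (F.gap 4).left_eq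
  have hd1' : d' 1 = -a' * cis (g' 0) := by rw [← hd']; exact (F'.gap 0).eq
  have ha0 : a ≠ 0 := by
    rintro rfl
    simp at ha
  have heq : A + a + d 4 = A + a' + d' 1 := by
    by_contra hne
    have h1 := hS _ (F.gap 4).left _ (F'.gap 0).right hne
    have h2 := norm_sub_lt_one ha hα p4 p0 hle
    refine absurd h1 (not_le.2 ?_)
    change ‖A + a + d 4 - (A + a' + d' 1)‖ < 1
    convert h2 using 2
    rw [hd4, hd1', ha']
    ring
  have na' : ‖a'‖ = 1 := by rw [ha', norm_mul, ha, norm_cis, one_mul]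
  have nd' : ‖d' 1‖ = 1 := (F'.gap 1).norm_left
  have hfac := mul_mul_eq_zero_of_norm_eq_one ha (F.gap 4).norm_left (z := -a')
    (by rwa [norm_neg]) (by
      rw [show a + d 4 + -a' = d' 1 by linear_combination heq]
      exact nd')
  have hne1 : a + d 4 ≠ 0 := by
    intro h
    rw [hd4] at h
    have h1 : a * (1 - cis (-g 4)) = 0 := by linear_combination h
    have h2 := (mul_eq_zero.1 h1).resolve_left ha0
    have h3 := eq_zero_of_cis_eq_one (x := -g 4) (by linarith) (by linarith [pi_pos])
      (by linear_combination -h2)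
    linarith [pi_pos]
  have hne2 : -a' + a ≠ 0 := by
    intro h
    rw [ha'] at h
    have h1 : a * (1 - cis α) = 0 := by linear_combination h
    have h2 := (mul_eq_zero.1 h1).resolve_left ha0
    have h3 := eq_zero_of_cis_eq_one (x := α) (by linarith [pi_pos]) (by linarith)
      (by linear_combination -h2)
    linarith [pi_pos]
  have hda : d 4 = a' := by
    rcases mul_eq_zero.1 hfac with h | h
    · rcases mul_eq_zero.1 h with h | h
      · exact absurd h hne1
      · linear_combination h
    · exact absurd h hne2
  have hda' : d' 1 = a := by linear_combination hda - heq
  have hαg : α = π - g 4 := by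
    have h1 : a * (cis (-g 4) * (cis (α - π + g 4) - 1)) = 0 := by
      have h2 : cis (-g 4) * cis (α - π + g 4) = -cis α := by
        rw [← cis_add, ← cis_neg_sub_pi]
        ring_nf
      rw [mul_sub, h2]
      linear_combination hda - hd4 + ha'
    have h2 := (mul_eq_zero.1 ((mul_eq_zero.1 h1).resolve_left ha0)).resolve_left (cis_ne_zero _)
    have h3 := eq_zero_of_cis_eq_one (x := α - π + g 4) (by linarith [pi_pos]) (by linarith)
      (by linear_combination h2)
    linarith
  have hαg' : α = π - g' 0 := by
    have h1 : a * (cis (α - π + g' 0) - 1) = 0 := by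
      have h2 : cis (α - π + g' 0) = -(cis α * cis (g' 0)) := by
        rw [← cis_add, ← cis_neg_sub_pi]
        ring_nf
      rw [h2]
      linear_combination hda' - hd1' + cis (g' 0) * ha'
    have h2 := (mul_eq_zero.1 h1).resolve_left ha0
    have h3 := eq_zero_of_cis_eq_one (x := α - π + g' 0) (by linarith [pi_pos]) (by linarith)
      (by linear_combination h2)
    linarith
  obtain ⟨f, k, FH, hf⟩ := (F.hasFans 4 (by decide)).exists_fan_neg F.mem (F.gap 4).norm_left
  have hk0 : k 0 = π / 3 :=
    (FH.edge hS F.toFan 0 3 (by rw [hf]; ring) (by rw [hf, neg_neg]; rfl)).1.2 hg3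
  have hk4 : π - g 4 ≤ k 4 := by linarith [(F.edge hS FH 4 4 rfl hf).2 hg4]
  have hf4 : f 4 = -a' * cis (-k 4) := by rw [← hda, ← hf]; exact (FH.gap 4).left_eq
  have hk4' : k 4 = α := by
    by_contra hne
    have hlt : α < k 4 := lt_of_le_of_ne (by linarith) (Ne.symm hne)
    refine (FH.gap 4).empty (k 4 - α) (by linarith) (by linarith [pi_pos]) ?_
    have h1 : f 4 * cis (k 4 - α) = -a := by
      rw [hf4, mul_assoc, ← cis_add, ha', show -k 4 + (k 4 - α) = -α by ring]
      linear_combination -a * cis_mul_cis_neg α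
    rw [h1, heq, hda']
    convert F'.mem using 1
    ring
  have hf4' : f 4 = -d' 1 := by
    rw [hf4, hk4', ha', hda']
    linear_combination -a * cis_mul_cis_neg α
  have hk3 : k 3 = π / 3 := (F'.edge hS FH 1 3 heq hf4').1.1 hg1'
  have hk12 : k 1 ≠ π / 3 ∨ k 2 ≠ π / 3 := by
    by_contra! h
    exact FH.not_three_triangles hC 0 hk0 h.1 h.2
  have hor : g 0 ≠ π / 3 ∨ A + a' * cis (π / 3) ∈ S := by
    by_cases h : g 0 = π / 3
    · right
      have h1 : d' 4 = -a' * cis (-(π / 3)) := by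
        rw [← hiff.1 h, ← hd']; exact (F'.gap 4).left_eq
      convert (F'.gap 4).left using 1
      rw [h1, cis_neg_pi_div_three]
      ring
    · exact Or.inl h
  have hor' : g' 4 ≠ π / 3 ∨ A + a * cis (-(π / 3)) ∈ S := by
    by_cases h : g' 4 = π / 3
    · right
      have h1 : d 1 = -a * cis (π / 3) := by
        rw [← hiff.2 h, ← hd]; exact (F.gap 0).eq
      convert (F.gap 0).right using 1
      rw [show d (0 + 1) = -a * cis (π / 3) from h1, cis_neg_pi_div_three]
      ring
    · exact Or.inl h
  rcases hk12 with hk1 | hk2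
  · refine F.not_rhombus_of_ne hS hC ha hd (F.hasFans 3 (by decide)) hg1 hg2 hg3 ?_
      (by rwa [hda]) FH hf hk0 hk1 hk4
    rw [hda, ha', hαg]
  · have G := F'.mirror
    have GH := (FH.rotate 4).mirror
    rw [heq, map_add, map_add] at GH
    rw [map_add] at G
    refine G.not_rhombus_of_ne hS.mirror hC.mirror (A := conj A) (a := conj a')
      (by rwa [Complex.norm_conj]) ?_ ?_ hg3' hg2' hg1' ?_ ?_ GH ?_ hk3 hk2 ?_
    · change conj (d' 0) = _
      rw [hd', map_neg]
    · have := (F'.hasFans 2 (by decide)).mirror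
      rwa [map_add, map_add] at this
    · change conj (d' 1) = conj a' * cis (π - g' 0)
      rw [← hαg', ha', map_mul, conj_cis, hda', mul_assoc, mul_comm (cis (-α)), cis_mul_cis_neg,
        mul_one]
    · change g' 4 ≠ π / 3 ∨ conj (conj A + conj (d' 1) * cis (π / 3)) ∈ S
      rwa [map_add, map_mul, conj_cis, Complex.conj_conj, Complex.conj_conj, hda']
    · change conj (f 4) = -conj (d' 1)
      rw [hf4', map_neg]
    · change π - g' 0 ≤ k 4
      linarith

end Quad

section DegreeFour

variable {S : Set ℂ}

/-- The two outer angles at the base of an equilateral triangle `A, A + a, A + a'`, when the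
neighbours `A + a` and `A + a'` are popular. -/
lemma PopularFan.add_le_pi (hS : Separated S) {A a a' : ℂ} {d d' : Fin 5 → ℂ} {g g' : Fin 5 → ℝ}
    (F : PopularFan S (A + a) d g) (F' : PopularFan S (A + a') d' g') (hd : d 0 = -a)
    (hd' : d' 0 = -a') (ha' : a' = a * cis (π / 3)) (hg1 : g 1 = π / 3) (hg2 : g 2 ≠ π / 3)
    (hg3 : g 3 = π / 3) (hg4 : g 4 = π / 3) (hg0' : g' 0 = π / 3) (hg1' : g' 1 = π / 3)
    (hg2' : g' 2 ≠ π / 3) (hg3' : g' 3 = π / 3) : g 0 + g' 4 ≤ π := by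
  have hz := cis_pi_div_three_sq
  have hz' := cis_neg_pi_div_three
  have hd4 : d 4 = -a * cis (-(π / 3)) := by rw [← hg4, ← hd]; exact (F.gap 4).left_eq
  have hd3 : d 3 = d 4 * cis (-(π / 3)) := by rw [← hg3]; exact (F.gap 3).left_eq
  have hd1' : d' 1 = -a' * cis (π / 3) := by rw [← hg0', ← hd']; exact (F'.gap 0).eq
  have hd2' : d' 2 = d' 1 * cis (π / 3) := by rw [← hg1']; exact (F'.gap 1).eq
  obtain ⟨c, k, FC, hc⟩ := (F.hasFans 3 (by decide)).exists_fan_neg F.mem (F.gap 3).norm_left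
  have hk4 : k 4 = π / 3 := (F.edge hS FC 3 4 rfl hc).1.1 hg3
  have hc4 : c 4 = -d 3 * cis (-(π / 3)) := by rw [← hk4, ← hc]; exact (FC.gap 4).left_eq
  have e1 := FC.edge hS F.toFan 0 2 (by rw [hc]; ring) (by rw [hc, neg_neg]; rfl)
  have i1 := e1.2 (fun h => hg2 (e1.1.1 h))
  rw [hz'] at hc4 hd3 hd4
  have i2 := (F'.edge hS FC 2 3 (by
    rw [hd2', hd1', hd3, hd4, ha']
    linear_combination (a * cis (π / 3)) * hz) (by
    change c 4 = _
    rw [hc4, hd2', hd1', hd3, hd4, ha']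
    linear_combination (a - 2 * a * cis (π / 3)) * hz)).2 hg2'
  linarith [F.sum_five, F'.sum_five, FC.sum_five, (FC.gap 1).le, (FC.gap 2).le]

/-- All the neighbours of `A` are popular. -/
def PopularNeighbors (S : Set ℂ) (A : ℂ) {n : ℕ} (a : Fin n → ℂ) : Prop :=
  ∀ i, ∃ b g, PopularFan S (A + a i) b g ∧ b 0 = -a i

lemma Fan.edges_of_popular (hS : Separated S) (hC : NoCollinear S) {A : ℂ} {a : Fin 4 → ℂ}
    {α : Fin 4 → ℝ} (F : Fan S A a α) (hP : PopularNeighbors S A a) :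
    ∃ (b : Fin 4 → Fin 5 → ℂ) (g : Fin 4 → Fin 5 → ℝ),
      (∀ i, PopularFan S (A + a i) (b i) (g i) ∧ b i 0 = -a i) ∧
      (∀ i, g i 1 = π / 3 ∧ g i 2 ≠ π / 3 ∧ g i 3 = π / 3) ∧
      (∀ i, (α i = π / 3 ↔ g i 4 = π / 3) ∧ (α i ≠ π / 3 → π ≤ α i + g i 4)) ∧
      (∀ i, (α i = π / 3 ↔ g (i + 1) 0 = π / 3) ∧ (α i ≠ π / 3 → π ≤ α i + g (i + 1) 0)) ∧
      (∀ i, α i ≠ π / 3 ∨ α (i + 1) ≠ π / 3) := by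
  choose b g hb using hP
  have hz := cis_pi_div_three_sq
  have hz' := cis_neg_pi_div_three
  have hr : ∀ i, (α i = π / 3 ↔ g i 4 = π / 3) ∧ (α i ≠ π / 3 → π ≤ α i + g i 4) :=
    fun i => F.edge hS (hb i).1.toFan i 4 rfl (hb i).2
  have hl : ∀ i, (α i = π / 3 ↔ g (i + 1) 0 = π / 3) ∧
      (α i ≠ π / 3 → π ≤ α i + g (i + 1) 0) := fun i => by
    have := (hb (i + 1)).1.edge hS F 0 i (by rw [(hb (i + 1)).2]; ring)
      (by rw [(hb (i + 1)).2, neg_neg])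
    rw [add_comm (α i)]
    exact ⟨this.1.symm, fun h => this.2 (fun h' => h (this.1.1 h'))⟩
  have hCC : ∀ i, g i 1 = π / 3 ∧ g i 2 ≠ π / 3 ∧ g i 3 = π / 3 ∧
      (g i 0 ≠ π / 3 ∨ g i 4 ≠ π / 3) := fun i => by
    refine ((hb i).1.cases hS hC).resolve_left ?_
    rintro ⟨h0, h1, h2, h3, h4⟩
    have hi : ∀ i : Fin 4, i + 3 + 1 = i := by decide
    have hα : α i = π / 3 := (hr i).1.2 h4
    have hα' : α (i + 3) = π / 3 := (hl (i + 3)).1.2 (by rwa [hi])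
    have hg0 : g (i + 1) 0 = π / 3 := (hl i).1.1 hα
    have ha : a (i + 1) = a i * cis (π / 3) := by rw [← hα]; exact (F.gap i).eq
    have hb4 : b i 4 = -a i * cis (-(π / 3)) := by
      rw [← h4, ← (hb i).2]; exact ((hb i).1.gap 4).left_eq
    have hb1 : b (i + 1) 1 = -a (i + 1) * cis (π / 3) := by
      rw [← hg0, ← (hb (i + 1)).2]; exact ((hb (i + 1)).1.gap 0).eq
    have e := (hb (i + 1)).1.edge hS (hb i).1.toFan 1 3 (by
      rw [hb1, ha]
      linear_combination a i * hz) (by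
      change b i 4 = _
      rw [hb4, hb1, ha, hz']
      linear_combination -a i * hz)
    rcases (hb (i + 1)).1.cases hS hC with h | h
    · refine F.not_three_triangles hC (i + 3) hα' ?_ ?_
      · rwa [hi]
      · rw [hi]
        exact (hr (i + 1)).1.2 h.2.2.2.2
    · exact h3 (e.1.1 h.1)
  refine ⟨b, g, hb, fun i => ⟨(hCC i).1, (hCC i).2.1, (hCC i).2.2.1⟩, hr, hl, fun i => ?_⟩
  rcases (hCC (i + 1)).2.2.2 with h | h
  · exact Or.inl (fun h' => h ((hl i).1.1 h'))
  · exact Or.inr (fun h' => h ((hr (i + 1)).1.1 h'))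

lemma Fan.sum_four {A : ℂ} {a : Fin 4 → ℂ} {α : Fin 4 → ℝ} (F : Fan S A a α) :
    α 0 + α 1 + α 2 + α 3 = 2 * π := by
  rw [← F.sum, Fin.sum_univ_four]

lemma Fan.exists_triangle_of_popular (hS : Separated S) (hC : NoCollinear S) {A : ℂ}
    {a : Fin 4 → ℂ} {α : Fin 4 → ℝ} (F : Fan S A a α) (hP : PopularNeighbors S A a) :
    ∃ i, α i = π / 3 := by
  by_contra! hα
  obtain ⟨b, g, hb, hg, hr, hl, -⟩ := F.edges_of_popular hS hC hP
  have key : ∀ i, g i 0 + g i 4 < π := fun i => by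
    have h := (hb i).1.sum_five
    rw [(hg i).1, (hg i).2.2] at h
    have := lt_of_le_of_ne ((hb i).1.gap 2).le (Ne.symm (hg i).2.1)
    linarith
  have l0 : π ≤ α 0 + g 1 0 := (hl 0).2 (hα 0)
  have l1 : π ≤ α 1 + g 2 0 := (hl 1).2 (hα 1)
  have l2 : π ≤ α 2 + g 3 0 := (hl 2).2 (hα 2)
  have l3 : π ≤ α 3 + g 0 0 := (hl 3).2 (hα 3)
  linarith [F.sum_four, (hr 0).2 (hα 0), (hr 1).2 (hα 1), (hr 2).2 (hα 2), (hr 3).2 (hα 3),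
    key 0, key 1, key 2, key 3]

lemma Fan.not_popular_of_triangle (hS : Separated S) (hC : NoCollinear S) {A : ℂ}
    {a : Fin 4 → ℂ} {α : Fin 4 → ℝ} (F : Fan S A a α) (hP : PopularNeighbors S A a)
    (h0 : α 0 = π / 3) : False := by
  obtain ⟨b, g, hb, hg, hr, hl, hα⟩ := F.edges_of_popular hS hC hP
  have key : ∀ i, g i 0 + g i 2 + g i 4 = 4 * π / 3 := fun i => by
    have h := (hb i).1.sum_five
    rw [(hg i).1, (hg i).2.2] at h
    linarith
  have key2 : ∀ i, π / 3 < g i 2 := fun i =>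
    lt_of_le_of_ne ((hb i).1.gap 2).le (Ne.symm (hg i).2.1)
  have h1 : α 1 ≠ π / 3 := (hα 0).resolve_left (not_not.2 h0)
  have h3 : α 3 ≠ π / 3 := (hα 3).resolve_right (not_not.2 h0)
  have p : ∀ i, α i ≠ π / 3 → π / 3 < α i := fun i h =>
    lt_of_le_of_ne (F.gap i).le (Ne.symm h)
  have face : ∀ i, α i ≠ π / 3 → (α (i + 3) = π / 3 ↔ α (i + 1) = π / 3) →
      5 * π / 3 < α i + g i 4 + g (i + 1) 0 := fun i hi hiff => by
    have hi3 : ∀ i : Fin 4, i + 3 + 1 = i := by decide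
    have e1 := (hl (i + 3)).1
    rw [hi3] at e1
    refine (hb i).1.lt_add hS hC (hb (i + 1)).1 (hb i).2 (hb (i + 1)).2 (F.gap i).norm_left
      (F.gap i).eq (p i hi) (hg i).1 (hg i).2.1 (hg i).2.2 (fun h => hi ((hr i).1.2 h))
      (fun h => hi ((hl i).1.2 h)) (hg (i + 1)).1 (hg (i + 1)).2.1 (hg (i + 1)).2.2 ?_
    rw [← e1, ← (hr (i + 1)).1]
    exact hiff
  have sum := F.sum_four
  have g04 : g 0 4 = π / 3 := (hr 0).1.1 h0
  have g10 : g 1 0 = π / 3 := (hl 0).1.1 h0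
  by_cases h2 : α 2 = π / 3
  · have f1 : 5 * π / 3 < α 1 + g 1 4 + g 2 0 := face 1 h1 (iff_of_true h0 h2)
    have f3 : 5 * π / 3 < α 3 + g 3 4 + g 0 0 := face 3 h3 (iff_of_true h2 h0)
    have g24 : g 2 4 = π / 3 := (hr 2).1.1 h2
    have g30 : g 3 0 = π / 3 := (hl 2).1.1 h2
    have a1 : a 1 = a 0 * cis (π / 3) := by rw [← h0]; exact (F.gap 0).eq
    have a3 : a 3 = a 2 * cis (π / 3) := by rw [← h2]; exact (F.gap 2).eq
    have q0 := (hb 0).1.add_le_pi hS (hb 1).1 (hb 0).2 (hb 1).2 a1 (hg 0).1 (hg 0).2.1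
      (hg 0).2.2 g04 g10 (hg 1).1 (hg 1).2.1 (hg 1).2.2
    have q2 := (hb 2).1.add_le_pi hS (hb 3).1 (hb 2).2 (hb 3).2 a3 (hg 2).1 (hg 2).2.1
      (hg 2).2.2 g24 g30 (hg 3).1 (hg 3).2.1 (hg 3).2.2
    linarith
  · have f2 : 5 * π / 3 < α 2 + g 2 4 + g 3 0 := face 2 h2 (iff_of_false h1 h3)
    have l1 : π ≤ α 1 + g 2 0 := (hl 1).2 h1
    have r3 := (hr 3).2 h3
    linarith [key 2, key2 2, key 3, key2 3]

/-- A point of degree four has a neighbour that is not popular. -/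
lemma Fan.not_popularNeighbors (hS : Separated S) (hC : NoCollinear S) {A : ℂ} {a : Fin 4 → ℂ}
    {α : Fin 4 → ℝ} (F : Fan S A a α) : ¬ PopularNeighbors S A a := by
  intro hP
  obtain ⟨i, hi⟩ := F.exists_triangle_of_popular hS hC hP
  exact (F.rotate i).not_popular_of_triangle hS hC (fun j => hP (j + i)) (by simpa using hi)

end DegreeFour

section Kernel

variable {S : Set ℂ}

lemma Fan.apply_ne_apply_zero {v : ℂ} {d : Fin 5 → ℂ} {g : Fin 5 → ℝ} (F : Fan S v d g)
    {i : Fin 5} (hi : i ≠ 0) : d i ≠ d 0 := by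
  have h0 : d 0 ≠ 0 := by
    intro h
    simpa [h] using (F.gap 0).norm_left
  have key : ∀ x, 0 < x → x < 2 * π → d i = d 0 * cis x → d i ≠ d 0 := fun x h1 h2 hx h => by
    have h3 : cis x = 1 := mul_left_cancel₀ h0 (by rw [← hx, h, mul_one])
    exact h1.ne' (eq_zero_of_cis_eq_one (by linarith) h2 h3)
  have e1 : d 1 = d 0 * cis (g 0) := (F.gap 0).eq
  have e2 : d 2 = d 0 * cis (g 0 + g 1) := by
    rw [cis_add, ← mul_assoc, ← e1]; exact (F.gap 1).eq
  have e3 : d 3 = d 0 * cis (g 0 + g 1 + g 2) := by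
    rw [cis_add, ← mul_assoc, ← e2]; exact (F.gap 2).eq
  have e4 : d 4 = d 0 * cis (g 0 + g 1 + g 2 + g 3) := by
    rw [cis_add, ← mul_assoc, ← e3]; exact (F.gap 3).eq
  have p0 := (F.gap 0).pos
  have p1 := (F.gap 1).pos
  have p2 := (F.gap 2).pos
  have p3 := (F.gap 3).pos
  have p4 := (F.gap 4).pos
  have hs := F.sum_five
  fin_cases i
  · exact absurd rfl hi
  · exact key _ p0 (by linarith) e1
  · exact key _ (by linarith) (by linarith) e2
  · exact key _ (by linarith) (by linarith) e3
  · exact key _ (by linarith) (by linarith) e4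

lemma Gap.eq_pi_div_three {v u w : ℂ} {g : ℝ} (h : Gap S v u g w)
    (hm : v + u * cis (π / 3) ∈ S) : g = π / 3 := by
  by_contra hne
  exact h.empty (π / 3) (by positivity) (lt_of_le_of_ne h.le (Ne.symm hne)) hm

lemma not_diamond (hS : Separated S) (hC : NoCollinear S) {v u : ℂ} (hu : ‖u‖ = 1)
    (hm : ∀ w ∈ ({u, u * cis (π / 3), u * cis (π / 3) * cis (π / 3)} : Set ℂ),
      v + w ∈ S ∧ HasFans 5 S (v + w))
    (h : HasFans 5 S v) : False := by
  have m0 := hm u (by simp)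
  have m1 := hm (u * cis (π / 3)) (by simp)
  have m2 := hm (u * cis (π / 3) * cis (π / 3)) (by simp)
  obtain ⟨d, g, F, hd⟩ := h u hu m0.1
  have hg0 : g 0 = π / 3 := (F.gap 0).eq_pi_div_three (by rw [hd]; exact m1.1)
  have hd1 : d 1 = u * cis (π / 3) := by rw [← hg0, ← hd]; exact (F.gap 0).eq
  have hg1 : g 1 = π / 3 := (F.gap 1).eq_pi_div_three (by rw [hd1]; exact m2.1)
  have hd2 : d 2 = u * cis (π / 3) * cis (π / 3) := by
    rw [← hd1]; nth_rw 1 [← hg1]; exact (F.gap 1).eq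
  exact F.not_kernel hS hC (by rw [hd]; exact m0.2) (by rw [hd1]; exact m1.2)
    (by rw [hd2]; exact m2.2) hg0 hg1

lemma eq_mul_cis_or_eq_mul_cis {u w : ℂ} (hu : ‖u‖ = 1) (hw : ‖w‖ = 1) (h : ‖w - u‖ = 1) :
    w = u * cis (π / 3) ∨ u = w * cis (π / 3) := by
  have key : ∀ z : ℂ, ‖z‖ = 1 → z * conj z = 1 := fun z hz => by
    rw [Complex.mul_conj, Complex.normSq_eq_norm_sq, hz]
    simp
  have h1 := key u hu
  have h2 := key w hw
  have h3 := key _ h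
  rw [map_sub] at h3
  have hz := cis_pi_div_three_sq
  have h4 : w * w - u * w + u * u = 0 := by
    linear_combination (-u * w) * h3 + (w - u) * u * h2 - (w - u) * w * h1
  have h5 : (w - u * cis (π / 3)) * (u - w * cis (π / 3)) = 0 := by
    linear_combination (-cis (π / 3)) * h4 + u * w * hz
  rcases mul_eq_zero.1 h5 with h6 | h6
  · exact Or.inl (sub_eq_zero.1 h6)
  · exact Or.inr (sub_eq_zero.1 h6)

end Kernel

section Transport

/-- The identification of the plane with `ℂ`. -/
noncomputable def toComplex : Pt ≃ₗᵢ[ℝ] ℂ := Complex.orthonormalBasisOneI.repr.symm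

variable {P : Finset Pt}

lemma separated_image (hP : PennyGP P) : Separated (toComplex '' (P : Set Pt)) := by
  rintro _ ⟨p, hp, rfl⟩ _ ⟨q, hq, rfl⟩ hne
  rw [← map_sub, LinearIsometryEquiv.norm_map, ← dist_eq_norm]
  exact hP.1 p hp q hq (fun h => hne (by rw [h]))

lemma noCollinear_image (hP : PennyGP P) : NoCollinear (toComplex '' (P : Set Pt)) := by
  rintro _ ⟨x, hx, rfl⟩ a b ⟨y, hy, hya⟩ ⟨z, hz, hzb⟩ ha hb hab him
  have hxy : x ≠ y := by
    rintro rfl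
    exact ha (by linear_combination -hya)
  have hxz : x ≠ z := by
    rintro rfl
    exact hb (by linear_combination -hzb)
  have hyz : y ≠ z := by
    rintro rfl
    exact hab (by linear_combination hzb - hya)
  refine hP.2 x hx y hy z hz hxy hxz hyz ?_
  obtain ⟨r, hr⟩ : ∃ r : ℝ, b = r * a := by
    have h1 : ((a * conj b).re : ℂ) = a * conj b := by
      apply Complex.ext
      · simp
      · rw [Complex.ofReal_im, him]
    have h2 : conj a * b = a * conj b := by
      have := congrArg conj h1
      rw [Complex.conj_ofReal, h1, map_mul, Complex.conj_conj] at this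
      exact this.symm
    have ha' : (Complex.normSq a : ℂ) ≠ 0 := by
      exact_mod_cast (Complex.normSq_pos.2 ha).ne'
    refine ⟨(a * conj b).re / Complex.normSq a, ?_⟩
    rw [Complex.ofReal_div, h1, ← h2, div_mul_eq_mul_div, eq_div_iff ha', ← Complex.mul_conj]
    ring
  rw [collinear_iff_of_mem (p₀ := x) (by simp)]
  refine ⟨y - x, ?_⟩
  intro p hp
  rcases hp with rfl | rfl | rfl
  · exact ⟨0, by simp⟩
  · exact ⟨1, by simp⟩
  · refine ⟨r, toComplex.injective ?_⟩
    rw [vadd_eq_add, map_add, map_smul, map_sub, hzb, hya, hr, Complex.real_smul]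
    ring

lemma deg_eq_ncard (p : Pt) :
    deg P p = {u : ℂ | ‖u‖ = 1 ∧ toComplex p + u ∈ toComplex '' (P : Set Pt)}.ncard := by
  have hinj : Function.Injective (fun q => toComplex q - toComplex p) := fun x y h =>
    toComplex.injective (sub_left_injective h)
  rw [deg, ← Set.ncard_image_of_injective _ hinj]
  congr 1
  ext u
  constructor
  · rintro ⟨q, ⟨hq, hd⟩, rfl⟩
    refine ⟨?_, q, hq, by ring⟩
    change ‖toComplex q - toComplex p‖ = 1
    rw [← hd, dist_comm, dist_eq_norm, ← map_sub, LinearIsometryEquiv.norm_map]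
  · rintro ⟨hu, q, hq, hqu⟩
    refine ⟨q, ⟨hq, ?_⟩, by simp [hqu]⟩
    rw [dist_comm, dist_eq_norm, ← toComplex.norm_map, map_sub, hqu, add_sub_cancel_left, hu]

lemma dist_eq_norm_toComplex_sub (p q : Pt) : dist p q = ‖toComplex q - toComplex p‖ := by
  rw [← map_sub, LinearIsometryEquiv.norm_map, dist_comm, dist_eq_norm]

lemma hasFans_of_deg (hP : PennyGP P) {p : Pt} (hp : p ∈ P) {m : ℕ} (h : deg P p = m + 1) :
    HasFans (m + 1) (toComplex '' (P : Set Pt)) (toComplex p) :=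
  hasFans_of_ncard (separated_image hP) ⟨p, hp, rfl⟩ (by rw [← deg_eq_ncard, h])

lemma deg_le_five (hP : PennyGP P) {p : Pt} (hp : p ∈ P) : deg P p ≤ 5 := by
  rw [deg_eq_ncard]
  exact ncard_le_five (separated_image hP) (noCollinear_image hP) ⟨p, hp, rfl⟩

lemma exists_mem_of_add_mem {p : Pt} {u : ℂ} (hu : ‖u‖ = 1)
    (h : toComplex p + u ∈ toComplex '' (P : Set Pt)) :
    ∃ q ∈ P, toComplex q = toComplex p + u ∧ dist p q = 1 := by
  obtain ⟨q, hq, hqu⟩ := h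
  refine ⟨q, hq, hqu, ?_⟩
  rw [dist_eq_norm_toComplex_sub, hqu, add_sub_cancel_left, hu]

/-- There are no kernels in general position. -/
lemma not_isKernel (hP : PennyGP P) {L U R D : Pt} : ¬ IsKernel P L U R D := by
  rintro ⟨hL, hU, hR, hD, hne, dL, dU, dR, dD, hLU, hUR, hRD, hDL, hLR⟩
  have hUD : U ≠ D := by
    simp only [List.pairwise_cons, List.mem_cons] at hne
    exact hne.2.1 D (by simp)
  set f := toComplex with hf
  have hS := separated_image hP
  have hC := noCollinear_image hP
  have hLU' : ‖f U - f L‖ = 1 := by rw [← dist_eq_norm_toComplex_sub, hLU]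
  have hLR' : ‖f R - f L‖ = 1 := by rw [← dist_eq_norm_toComplex_sub, hLR]
  have hLD' : ‖f D - f L‖ = 1 := by rw [← dist_eq_norm_toComplex_sub, dist_comm, hDL]
  have hm : ∀ X, X ∈ P → deg P X = 5 →
      f L + (f X - f L) ∈ f '' (P : Set Pt) ∧ HasFans 5 (f '' (P : Set Pt)) (f L + (f X - f L)) :=
    fun X hX hd => by
      rw [add_sub_cancel]
      exact ⟨⟨X, hX, rfl⟩, hasFans_of_deg hP hX hd⟩
  have key : ∀ X ∈ P, ∀ Y ∈ P, deg P X = 5 → deg P Y = 5 → ‖f X - f L‖ = 1 →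
      f R - f L = (f X - f L) * cis (π / 3) → f Y - f L = (f R - f L) * cis (π / 3) → False := by
    intro X hX Y hY dX dY hLX h1 h2
    refine not_diamond hS hC hLX ?_ (hasFans_of_deg hP hL dL)
    rw [← h1, ← h2]
    rintro w (rfl | rfl | rfl)
    · exact hm X hX dX
    · exact hm R hR dR
    · exact hm Y hY dY
  have hRU : ‖(f R - f L) - (f U - f L)‖ = 1 := by
    rw [sub_sub_sub_cancel_right, ← dist_eq_norm_toComplex_sub, hUR]
  have hRD' : ‖(f R - f L) - (f D - f L)‖ = 1 := by
    rw [sub_sub_sub_cancel_right, ← dist_eq_norm_toComplex_sub, dist_comm, hRD]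
  rcases eq_mul_cis_or_eq_mul_cis hLU' hLR' hRU with h1 | h1 <;>
    rcases eq_mul_cis_or_eq_mul_cis hLD' hLR' hRD' with h2 | h2
  · have h3 := mul_right_cancel₀ (cis_ne_zero _) (h1.symm.trans h2)
    exact hUD (f.injective (sub_left_injective h3))
  · exact key U hU D hD dU dD hLU' h1 h2
  · exact key D hD U hU dD dU hLD' h2 h1
  · exact hUD (f.injective (sub_left_injective (h1.trans h2.symm)))

end Transport

/-- Every point of degree 4 in a penny configuration in general position has an
unpopular unit-neighbor that does not belong to any kernel. -/
theorem degree_four_has_unpopular_neighbor (P : Finset Pt) (hP : PennyGP P)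
    (A : Pt) (hA : A ∈ P) (hdA : deg P A = 4) :
    ∃ B ∈ P, dist A B = 1 ∧ Unpopular P B ∧ ¬ InKernel P B := by
  by_contra! hcon
  have hS := separated_image hP
  have hC := noCollinear_image hP
  have hpop : ∀ B ∈ P, dist A B = 1 → ¬ Unpopular P B := fun B hB hAB hu => by
    obtain ⟨L, U, R, D, hk, -⟩ := hcon B hB hAB hu
    exact not_isKernel hP hk
  have hdB : ∀ B ∈ P, dist A B = 1 → deg P B = 5 := fun B hB hAB => by
    have h1 := deg_le_five hP hB
    have h2 : ¬ deg P B ≤ 4 := fun h => hpop B hB hAB (Or.inl h)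
    omega
  have hdC : ∀ B ∈ P, dist A B = 1 → ∀ C ∈ P, dist B C = 1 → C ≠ A → deg P C = 5 :=
    fun B hB hAB C hC hBC hCA => by
      have h1 := deg_le_five hP hC
      have h2 : ¬ deg P C ≤ 3 := fun h =>
        hpop B hB hAB (Or.inr (Or.inl ⟨hdB B hB hAB, C, hC, hBC, h⟩))
      have h3 : deg P C ≠ 4 := fun h =>
        hpop B hB hAB (Or.inr (Or.inr ⟨hdB B hB hAB, C, hC, A, hA, hCA, hBC,
          by rwa [dist_comm], h, hdA⟩))
      omega
  have hne : {u : ℂ | ‖u‖ = 1 ∧ toComplex A + u ∈ toComplex '' (P : Set Pt)}.Nonempty := by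
    apply Set.nonempty_of_ncard_ne_zero
    rw [← deg_eq_ncard, hdA]
    norm_num
  obtain ⟨u, hu, huS⟩ := hne
  obtain ⟨a, α, F, -⟩ := hasFans_of_deg hP hA hdA u hu huS
  refine F.not_popularNeighbors hS hC (fun i => ?_)
  obtain ⟨B, hB, hBa, hAB⟩ := exists_mem_of_add_mem (F.gap i).norm_left (F.gap i).left
  rw [← hBa]
  obtain ⟨b, g, G, hb⟩ := hasFans_of_deg hP hB (hdB B hB hAB) (-a i)
    (by rw [norm_neg]; exact (F.gap i).norm_left)
    (by rw [hBa, add_neg_cancel_right]; exact F.mem)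
  refine ⟨b, g, ⟨G, fun j hj => ?_⟩, hb⟩
  obtain ⟨C, hC', hCb, hBC⟩ := exists_mem_of_add_mem (G.gap j).norm_left (G.gap j).left
  rw [← hCb]
  refine hasFans_of_deg hP hC' (hdC B hB hAB C hC' hBC ?_)
  rintro rfl
  refine G.apply_ne_apply_zero hj ?_
  rw [hb]
  linear_combination -hCb - hBa
end

section
/- Define, for real x, a(x) = −1/2 − √3·sin(x + π/3), b(x) = √3/2 + √3·cos(x + π/3), and φ(x) = arctan(b(x)/a(x)) + arccos(√(a(x)² + b(x)²)/2). Then for every x with π/3 < x < 2π/3 one has π − φ(π − x) − φ(x) < π/3 (equivalently φ(x) + φ(π − x) > 2π/3), while for x = π/3 and for x = 2π/3 one has π − φ(π − x) − φ(x) = π/3. -/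
open Real

/-- `a x = −1/2 − √3·sin(x + π/3)`. -/
noncomputable def a (x : ℝ) : ℝ := -1 / 2 - Real.sqrt 3 * sin (x + π / 3)

/-- `b x = √3/2 + √3·cos(x + π/3)`. -/
noncomputable def b (x : ℝ) : ℝ := Real.sqrt 3 / 2 + Real.sqrt 3 * cos (x + π / 3)

/-- `φ x = arctan (b x / a x) + arccos (√(a x ² + b x ²) / 2)`. -/
noncomputable def φ (x : ℝ) : ℝ :=
  arctan (b x / a x) + arccos (Real.sqrt (a x ^ 2 + b x ^ 2) / 2)

/-- If a right-half-plane vector `(X, Y)` has squared length less than twice its component in the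
direction `ψ ≤ π + arctan (Y / X)`, then the unit vector at angle `arccos (r / 2)` counterclockwise
from `(X, Y)` lies beyond the direction `ψ`. -/
lemma lt_arctan_add_arccos {X Y ψ : ℝ} (hX : 0 < X) (hr : X ^ 2 + Y ^ 2 ≤ 4)
    (hψ : ψ - arctan (Y / X) ≤ π)
    (h : X ^ 2 + Y ^ 2 < 2 * (X * cos ψ + Y * sin ψ)) :
    ψ < arctan (Y / X) + arccos (√(X ^ 2 + Y ^ 2) / 2) := by
  set θ := arctan (Y / X) with hθ
  set r := √(X ^ 2 + Y ^ 2)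
  have hr_pos : 0 < r := sqrt_pos.2 (by positivity)
  have hr_sq : r ^ 2 = X ^ 2 + Y ^ 2 := sq_sqrt (by positivity)
  have hcos_pos : 0 < cos θ := cos_arctan_pos _
  have hsin : X * sin θ = Y * cos θ := by
    have htan : sin θ / cos θ = Y / X := by rw [← tan_eq_sin_div_cos, hθ, tan_arctan]
    rw [div_eq_div_iff hcos_pos.ne' hX.ne'] at htan
    linarith
  have hcos : r * cos θ = X := by
    refine (sq_eq_sq₀ (by positivity) hX.le).1 ?_
    rw [mul_pow, hr_sq]
    linear_combination (-X * sin θ - Y * cos θ) * hsin + X ^ 2 * sin_sq_add_cos_sq θ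
  have hsin' : r * sin θ = Y := by
    apply mul_left_cancel₀ hX.ne'
    linear_combination r * hsin + Y * hcos
  by_contra! hle
  have hcos_le : cos (ψ - θ) ≤ r / 2 := by
    have := cos_le_cos_of_nonneg_of_le_pi (arccos_nonneg (r / 2)) hψ (by linarith)
    rwa [cos_arccos (by linarith) (by nlinarith)] at this
  have hproj : r * cos (ψ - θ) = X * cos ψ + Y * sin ψ := by
    rw [cos_sub]
    linear_combination cos ψ * hcos + sin ψ * hsin'
  nlinarith

lemma two_mul_sub_lt_φ {x : ℝ} (h₁ : π / 3 < x) (h₂ : x < 2 * π / 3) :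
    2 * (x - π / 3) < φ x := by
  obtain ⟨v, rfl⟩ : ∃ v, x = 2 * π / 3 - v := ⟨2 * π / 3 - x, by ring⟩
  have hv_pos : 0 < v := by linarith
  have hv_lt : v < π / 3 := by linarith
  have h3 : √3 ^ 2 = 3 := sq_sqrt (by norm_num)
  have h3_pos : 0 < √3 := by positivity
  have hC_gt : 1 / 2 < cos v := by
    rw [← cos_pi_div_three]
    exact cos_lt_cos_of_nonneg_of_le_pi hv_pos.le (by linarith [pi_pos]) hv_lt
  have hC_lt : cos v < 1 := by
    rw [← cos_zero]
    exact cos_lt_cos_of_nonneg_of_le_pi le_rfl (by linarith [pi_pos]) hv_pos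
  have hS_pos : 0 < sin v := sin_pos_of_pos_of_lt_pi hv_pos (by linarith [pi_pos])
  have hS_lt : sin v < √3 / 2 := by
    rw [← sin_pi_div_three]
    exact sin_lt_sin_of_lt_of_le_pi_div_two (by linarith) (by linarith [pi_pos]) hv_lt
  have hpyth := sin_sq_add_cos_sq v
  have hangle : 2 * π / 3 - v + π / 3 = π - v := by ring
  have ha : a (2 * π / 3 - v) = -(1 / 2 + √3 * sin v) := by
    rw [a, hangle, sin_pi_sub]; ring
  have hb : b (2 * π / 3 - v) = -(√3 * (cos v - 1 / 2)) := by
    rw [b, hangle, cos_pi_sub]; ring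
  have hnorm : (1 / 2 + √3 * sin v) ^ 2 + (√3 * (cos v - 1 / 2)) ^ 2
      = 4 + √3 * sin v - 3 * cos v := by
    linear_combination (sin v ^ 2 + (cos v - 1 / 2) ^ 2) * h3 + 3 * hpyth
  have hψ : 2 * (2 * π / 3 - v - π / 3) = π - π / 3 - 2 * v := by ring
  have hcosψ : cos (π - π / 3 - 2 * v)
      = -1 / 2 * (2 * cos v ^ 2 - 1) + √3 / 2 * (2 * sin v * cos v) := by
    rw [cos_sub, cos_pi_sub, sin_pi_sub, cos_pi_div_three, sin_pi_div_three, cos_two_mul,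
      sin_two_mul]
    ring
  have hsinψ : sin (π - π / 3 - 2 * v)
      = √3 / 2 * (2 * cos v ^ 2 - 1) + 1 / 2 * (2 * sin v * cos v) := by
    rw [sin_sub, cos_pi_sub, sin_pi_sub, cos_pi_div_three, sin_pi_div_three, cos_two_mul,
      sin_two_mul]
    ring
  have harctan : 0 < arctan (√3 * (cos v - 1 / 2) / (1 / 2 + √3 * sin v)) :=
    arctan_pos.2 (div_pos (mul_pos h3_pos (by linarith)) (by positivity))
  rw [φ, ha, hb, neg_div_neg_eq, neg_sq, neg_sq, hψ]
  apply lt_arctan_add_arccos (by positivity)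
  · rw [hnorm]
    nlinarith
  · linarith [pi_pos]
  · rw [hnorm, hcosψ, hsinψ]
    have hpos : 0 < (2 * cos v - 1) * (1 - cos v) := mul_pos (by linarith) (by linarith)
    linear_combination 2 * hpos
      - (2 * sin v ^ 2 * cos v + (cos v - 1 / 2) * (2 * cos v ^ 2 - 1)) * h3 - 6 * cos v * hpyth

lemma φ_pi_div_three : φ (π / 3) = 0 := by
  have hangle : π / 3 + π / 3 = π - π / 3 := by ring
  have h3 : √3 * √3 = 3 := mul_self_sqrt (by norm_num)
  have ha : a (π / 3) = -2 := by
    rw [a, hangle, sin_pi_sub, sin_pi_div_three]; linarith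
  have hb : b (π / 3) = 0 := by
    rw [b, hangle, cos_pi_sub, cos_pi_div_three]; ring
  have hsqrt : √((-2 : ℝ) ^ 2 + 0 ^ 2) = 2 := by
    rw [sqrt_eq_iff_mul_self_eq] <;> norm_num
  rw [φ, ha, hb, hsqrt]
  simp

lemma φ_two_mul_pi_div_three : φ (2 * π / 3) = 2 * π / 3 := by
  have hangle : 2 * π / 3 + π / 3 = π := by ring
  have h3 : √3 ^ 2 = 3 := sq_sqrt (by norm_num)
  have ha : a (2 * π / 3) = -1 / 2 := by
    rw [a, hangle, sin_pi]; ring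
  have hb : b (2 * π / 3) = -√3 / 2 := by
    rw [b, hangle, cos_pi]; ring
  have hdiv : -√3 / 2 / (-1 / 2) = tan (π / 3) := by rw [tan_pi_div_three]; ring
  have hnorm : (-1 / 2) ^ 2 + (-√3 / 2) ^ 2 = 1 := by linear_combination h3 / 4
  rw [φ, ha, hb, hnorm, sqrt_one, hdiv, arctan_tan (by linarith [pi_pos]) (by linarith [pi_pos]),
    ← cos_pi_div_three, arccos_cos (by positivity) (by linarith [pi_pos])]
  ring

/-- For every `x` with `π/3 < x < 2π/3` one has `π − φ(π − x) − φ(x) < π/3`, while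
for `x = π/3` and `x = 2π/3` one has `π − φ(π − x) − φ(x) = π/3`. -/
theorem angle_claim :
    (∀ x : ℝ, π / 3 < x → x < 2 * π / 3 → π - φ (π - x) - φ x < π / 3) ∧
    π - φ (π - π / 3) - φ (π / 3) = π / 3 ∧
    π - φ (π - 2 * π / 3) - φ (2 * π / 3) = π / 3 := by
  refine ⟨fun x h₁ h₂ => ?_, ?_, ?_⟩
  · have hx := two_mul_sub_lt_φ h₁ h₂
    have hx' := two_mul_sub_lt_φ (x := π - x) (by linarith) (by linarith)
    linarith
  · rw [show π - π / 3 = 2 * π / 3 by ring, φ_pi_div_three, φ_two_mul_pi_div_three]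
    ring
  · rw [show π - 2 * π / 3 = π / 3 by ring, φ_pi_div_three, φ_two_mul_pi_div_three]
    ring
end
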